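/- There exist a constant C₆ > 0 and N ∈ ℕ such that for all n ≥ N and all integers m with n ≤ m ≤ 2n, one has |Var(𝔇_{τ_m^𝔅} − 𝔇_{τ_n^𝔅}) − 2(m − n)| ≤ C₆·n^{3/4} + C₆·(m−n)²/n. -/

import Mathlib

open MeasureTheory ProbabilityTheory Filter

/-- The asymptotic condition `1/w(n) = n^α (1 + 2B/n + O(1/n²))` on the weight function. -/
def WeightAsymp (w : ℕ → ℝ) (α B : ℝ) : Prop :=
  ∃ C₀ > (0:ℝ), ∃ N₀ : ℕ, ∀ n : ℕ, N₀ ≤ n →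
    |1 / w n - (n:ℝ) ^ α - 2 * B * (n:ℝ) ^ (α - 1)| ≤ C₀ * (n:ℝ) ^ (α - 2)

/-- The three admissible choices of `(b, r)` in terms of the weight function `w`. -/
def UrnChoice (w b r : ℕ → ℝ) : Prop :=
  (∀ i, b i = w (2*i) ∧ r i = w (2*i+1)) ∨
  (∀ i, b i = w (2*i+1) ∧ r i = w (2*i)) ∨
  (∀ i, b i = w (2*i) ∧ r i = w (2*i))

/-- A generalized Pólya urn process: `Bl n` and `Re n` are the numbers of blue and red
balls drawn in the first `n` draws; started at `(0,0)`, exactly one coordinate increases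
by `1` at each step, and conditionally on the past the blue coordinate increases with
probability `b(Bl n)/(b(Bl n) + r(Re n))`. -/
structure Urn {Ω : Type*} [MeasurableSpace Ω] (μ : Measure Ω) (b r : ℕ → ℝ) where
  Bl : ℕ → Ω → ℕ
  Re : ℕ → Ω → ℕ
  meas_Bl : ∀ n, Measurable (Bl n)
  meas_Re : ∀ n, Measurable (Re n)
  init_Bl : ∀ ω, Bl 0 ω = 0
  init_Re : ∀ ω, Re 0 ω = 0
  step : ∀ n ω, (Bl (n+1) ω = Bl n ω + 1 ∧ Re (n+1) ω = Re n ω) ∨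
                (Bl (n+1) ω = Bl n ω ∧ Re (n+1) ω = Re n ω + 1)
  markov : ∀ n : ℕ,
    μ[(fun ω => if Bl (n+1) ω = Bl n ω + 1 then (1:ℝ) else 0) |
        ⨆ j ∈ Set.Iic n, MeasurableSpace.comap (fun ω => (Bl j ω, Re j ω)) inferInstance]
      =ᵐ[μ] fun ω => b (Bl n ω) / (b (Bl n ω) + r (Re n ω))

namespace Urn

variable {Ω : Type*} [MeasurableSpace Ω] {μ : Measure Ω} {b r : ℕ → ℝ}

/-- The discrepancy `𝔇_n = ℜ_n − 𝔅_n`. -/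
def D (U : Urn μ b r) (n : ℕ) (ω : Ω) : ℤ := (U.Re n ω : ℤ) - (U.Bl n ω : ℤ)

/-- `τ_k^𝔅`, the number of draws until the `k`-th blue ball. -/
noncomputable def tau (U : Urn μ b r) : ℕ → Ω → ℕ
  | 0 => fun _ => 0
  | k+1 => fun ω => sInf {n : ℕ | U.tau k ω < n ∧ U.Bl n ω = U.Bl (n-1) ω + 1}

/-- The natural filtration `ℱ_n = σ((𝔅_j, ℜ_j), j ≤ n)`. -/
def F (U : Urn μ b r) (n : ℕ) : MeasurableSpace Ω :=
  ⨆ j ∈ Set.Iic n, MeasurableSpace.comap (fun ω => (U.Bl j ω, U.Re j ω)) inferInstance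

end Urn

/-- `a` lies between the shifts by `-q` and `q` of the power function `j ↦ (2 j) ^ α`. -/
def PowerSandwich (α : ℝ) (q : ℕ) (a : ℕ → ℝ) : Prop :=
  ∀ j : ℕ, (2 * ((j - q : ℕ) : ℝ)) ^ α ≤ a j ∧ a j ≤ (2 * ((j + q : ℕ) : ℝ)) ^ α

/-- A sequence `v n = n ^ α (1 + O(1/n))` lies between shifts of the power function. -/
lemma exists_shift_rpow_sandwich {α C : ℝ} (hα : 0 < α) {v : ℕ → ℝ} (hv : ∀ n, 0 < v n)
    {N₁ : ℕ} (h : ∀ n : ℕ, N₁ ≤ n → |v n - (n : ℝ) ^ α| ≤ C * (n : ℝ) ^ (α - 1)) :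
    ∃ q : ℕ, ∀ n : ℕ, ((n - q : ℕ) : ℝ) ^ α ≤ v n ∧ v n ≤ ((n + q : ℕ) : ℝ) ^ α := by
  obtain ⟨p, hp⟩ := exists_nat_ge (2 * |C| / α)
  obtain ⟨N₂, hN₂⟩ := exists_nat_ge (α * p)
  set N := N₁ + N₂ + p + 1 with hN
  obtain ⟨M, hM⟩ := exists_nat_ge (∑ n ∈ Finset.range N, v n ^ (1 / α))
  have hCp : 2 * |C| ≤ α * p := by rw [div_le_iff₀ hα] at hp; linarith
  refine ⟨N + M, fun n => ?_⟩
  rcases lt_or_ge n N with hn | hn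
  · constructor
    · have : n - (N + M) = 0 := by omega
      rw [this]; simpa [Real.zero_rpow hα.ne'] using (hv n).le
    · have h1 : v n ^ (1 / α) ≤ M := by
        refine le_trans ?_ hM
        exact Finset.single_le_sum (f := fun n => v n ^ (1 / α))
          (fun i _ => Real.rpow_nonneg (hv i).le _) (Finset.mem_range.2 hn)
      calc v n = (v n ^ (1 / α)) ^ α := by
            rw [← Real.rpow_mul (hv n).le]; field_simp; simp
        _ ≤ _ := by
            apply Real.rpow_le_rpow (Real.rpow_nonneg (hv n).le _) _ hα.le
            push_cast; linarith [(Nat.cast_nonneg n : (0:ℝ) ≤ n), (Nat.cast_nonneg N : (0:ℝ) ≤ N)]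
  · have hn1 : (1:ℝ) ≤ n := by exact_mod_cast (by omega : 1 ≤ n)
    have hn0 : (0:ℝ) < n := by linarith
    have hpn : (p:ℝ) ≤ n := by exact_mod_cast (by omega : p ≤ n)
    have hαp : α * p ≤ n := hN₂.trans (by exact_mod_cast (by omega : N₂ ≤ n))
    have hb := h n (by omega)
    have hpow : (n:ℝ) ^ (α - 1) = (n:ℝ) ^ α / n := by rw [Real.rpow_sub hn0, Real.rpow_one]
    have hP : 0 < (n:ℝ) ^ α := Real.rpow_pos_of_pos hn0 _
    rw [hpow, abs_le] at hb
    have hC1 : C * ((n:ℝ) ^ α / n) ≤ (n:ℝ) ^ α * (α * (p / n) / 2) := by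
      rw [show C * ((n:ℝ) ^ α / n) = (n:ℝ) ^ α * (C / n) by ring,
        show α * ((p:ℝ) / n) / 2 = (α * p / 2) / n by ring]
      gcongr
      linarith [le_abs_self C]
    have hy0 : (0:ℝ) ≤ p / n := by positivity
    have hy1 : (p:ℝ) / n ≤ 1 := by rw [div_le_one hn0]; exact hpn
    have hy2 : α * ((p:ℝ) / n) ≤ 1 := by rw [← mul_div_assoc, div_le_one hn0]; exact hαp
    constructor
    · have h1 : ((n - (N + M) : ℕ) : ℝ) ≤ n * (1 - p / n) := by
        have : n * (1 - (p:ℝ) / n) = ((n - p : ℕ) : ℝ) := by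
          rw [Nat.cast_sub (by omega)]; field_simp
        rw [this]; exact_mod_cast (by omega)
      have h2 : (1 - (p:ℝ) / n) ^ α ≤ 1 - α * (p / n) / 2 := by
        have h3 : (1 - (p:ℝ) / n) ≤ Real.exp (-(p / n)) := by
          linarith [Real.add_one_le_exp (-((p:ℝ) / n))]
        have h4 : (1 - (p:ℝ) / n) ^ α ≤ Real.exp (-(α * (p / n))) := by
          refine (Real.rpow_le_rpow (by linarith) h3 hα.le).trans_eq ?_
          rw [← Real.exp_mul]; congr 1; ring
        refine h4.trans ?_
        set y := α * ((p:ℝ) / n)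
        have hy : 0 ≤ y := by positivity
        have h5 : Real.exp (-y) ≤ 1 / (1 + y) := by
          rw [Real.exp_neg, ← one_div]
          exact one_div_le_one_div_of_le (by linarith) (by linarith [Real.add_one_le_exp y])
        refine h5.trans ?_
        rw [div_le_iff₀ (by linarith)]
        nlinarith
      calc ((n - (N + M) : ℕ) : ℝ) ^ α ≤ (n * (1 - p / n)) ^ α :=
            Real.rpow_le_rpow (Nat.cast_nonneg _) h1 hα.le
        _ = (n:ℝ) ^ α * (1 - p / n) ^ α := Real.mul_rpow hn0.le (by linarith)
        _ ≤ (n:ℝ) ^ α * (1 - α * (p / n) / 2) := by gcongr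
        _ ≤ v n := by linarith
    · have h1 : (n:ℝ) * (1 + p / n) ≤ ((n + (N + M) : ℕ) : ℝ) := by
        have : n * (1 + (p:ℝ) / n) = ((n + p : ℕ) : ℝ) := by push_cast; field_simp
        rw [this]; exact_mod_cast (by omega)
      have h2 : 1 + α * ((p:ℝ) / n) / 2 ≤ (1 + (p:ℝ) / n) ^ α := by
        have h3 : ((p:ℝ) / n) / 2 ≤ Real.log (1 + p / n) := by
          have := Real.one_sub_inv_le_log_of_pos (by linarith : (0:ℝ) < 1 + p / n)
          refine le_trans ?_ this
          rw [le_sub_iff_add_le, ← le_sub_iff_add_le', inv_le_comm₀ (by linarith) (by linarith)]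
          rw [inv_le_iff_one_le_mul₀ (by linarith)]
          nlinarith
        rw [Real.rpow_def_of_pos (by linarith)]
        nlinarith [Real.add_one_le_exp (Real.log (1 + (p:ℝ) / n) * α)]
      calc v n ≤ (n:ℝ) ^ α * (1 + α * (p / n) / 2) := by linarith
        _ ≤ (n:ℝ) ^ α * (1 + p / n) ^ α := by gcongr
        _ = (n * (1 + p / n)) ^ α := (Real.mul_rpow hn0.le (by linarith)).symm
        _ ≤ _ := Real.rpow_le_rpow (by positivity) h1 hα.le

lemma WeightAsymp.exists_shift_sandwich {w : ℕ → ℝ} {α B : ℝ} (hα : 0 < α) (hw : ∀ n, 0 < w n)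
    (h : WeightAsymp w α B) :
    ∃ q : ℕ, ∀ n : ℕ, ((n - q : ℕ) : ℝ) ^ α ≤ (w n)⁻¹ ∧ (w n)⁻¹ ≤ ((n + q : ℕ) : ℝ) ^ α := by
  obtain ⟨C, hC, N, hN⟩ := h
  refine exists_shift_rpow_sandwich (C := C + 2 * |B|) (N₁ := N + 1) hα
    (fun n => inv_pos.2 (hw n)) fun n hn => ?_
  have hn1 : (1:ℝ) ≤ n := by exact_mod_cast (by omega : 1 ≤ n)
  have h1 := hN n (by omega)
  have h2 : (n:ℝ) ^ (α - 2) ≤ (n:ℝ) ^ (α - 1) :=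
    Real.rpow_le_rpow_of_exponent_le hn1 (by linarith)
  have hP : 0 ≤ (n:ℝ) ^ (α - 1) := by positivity
  rw [one_div] at h1
  calc |(w n)⁻¹ - (n:ℝ) ^ α| = |((w n)⁻¹ - (n:ℝ) ^ α - 2 * B * (n:ℝ) ^ (α - 1))
        + 2 * B * (n:ℝ) ^ (α - 1)| := by ring_nf
    _ ≤ C * (n:ℝ) ^ (α - 2) + |2 * B * (n:ℝ) ^ (α - 1)| := (abs_add_le _ _).trans (by gcongr)
    _ ≤ C * (n:ℝ) ^ (α - 1) + 2 * |B| * (n:ℝ) ^ (α - 1) := by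
        rw [abs_mul, abs_mul, abs_two, abs_of_nonneg hP]; gcongr
    _ = _ := by ring

lemma UrnChoice.exists_powerSandwich {w b r : ℕ → ℝ} {α B : ℝ} (hα : 0 < α) (hw : ∀ n, 0 < w n)
    (h : WeightAsymp w α B) (hc : UrnChoice w b r) :
    ∃ q : ℕ, PowerSandwich α q (fun i => (b i)⁻¹) ∧ PowerSandwich α q (fun i => (r i)⁻¹) := by
  obtain ⟨q, hq⟩ := h.exists_shift_sandwich hα hw
  have h0 : PowerSandwich α (q + 1) (fun i => (w (2 * i))⁻¹) := fun j =>
    ⟨le_trans (Real.rpow_le_rpow (by positivity) (by exact_mod_cast (by omega)) hα.le)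
      (hq (2 * j)).1,
     (hq (2 * j)).2.trans
      (Real.rpow_le_rpow (by positivity) (by exact_mod_cast (by omega)) hα.le)⟩
  have h1 : PowerSandwich α (q + 1) (fun i => (w (2 * i + 1))⁻¹) := fun j =>
    ⟨le_trans (Real.rpow_le_rpow (by positivity) (by exact_mod_cast (by omega)) hα.le)
      (hq (2 * j + 1)).1,
     (hq (2 * j + 1)).2.trans
      (Real.rpow_le_rpow (by positivity) (by exact_mod_cast (by omega)) hα.le)⟩
  refine ⟨q + 1, ?_⟩
  rcases hc with hc | hc | hc
  · simpa only [(hc _).1, (hc _).2] using And.intro h0 h1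
  · simpa only [(hc _).1, (hc _).2] using And.intro h1 h0
  · simpa only [(hc _).1, (hc _).2] using And.intro h0 h0

namespace Urn

variable {Ω : Type*} [MeasurableSpace Ω] {μ : Measure Ω} {b r : ℕ → ℝ} (U : Urn μ b r)

lemma Bl_add_Re (n : ℕ) (ω : Ω) : U.Bl n ω + U.Re n ω = n := by
  induction n with
  | zero => simp [U.init_Bl, U.init_Re]
  | succ n ih => rcases U.step n ω with h | h <;> omega

lemma Bl_mono (ω : Ω) : Monotone fun n => U.Bl n ω :=
  monotone_nat_of_le_succ fun n => by rcases U.step n ω with h | h <;> omega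

/-- The number of red balls drawn before the `k`-th blue ball. -/
noncomputable def redBefore (k : ℕ) (ω : Ω) : ℕ := sInf {j | k ≤ U.Bl (k + j) ω}

/-- Infinitely many blue balls are drawn along `ω`. -/
def BlueUnbounded (ω : Ω) : Prop := ∀ k, ∃ t, k ≤ U.Bl t ω

variable {U}

namespace BlueUnbounded

variable {ω : Ω}

lemma nonempty (h : U.BlueUnbounded ω) (k : ℕ) : {j | k ≤ U.Bl (k + j) ω}.Nonempty := by
  obtain ⟨t, ht⟩ := h k
  have := U.Bl_add_Re t ω
  refine ⟨t - k, ?_⟩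
  rw [Set.mem_ofPred_eq, show k + (t - k) = t by omega]
  exact ht

lemma redBefore_le_iff (h : U.BlueUnbounded ω) (k j : ℕ) :
    U.redBefore k ω ≤ j ↔ k ≤ U.Bl (k + j) ω :=
  ⟨fun hj => (Nat.sInf_mem (h.nonempty k)).trans (U.Bl_mono ω (by simpa [redBefore] using hj)),
    fun hj => Nat.sInf_le hj⟩

lemma add_redBefore_le_iff (h : U.BlueUnbounded ω) (k t : ℕ) :
    k + U.redBefore k ω ≤ t ↔ k ≤ U.Bl t ω := by
  have ht := U.Bl_add_Re t ω
  rcases le_or_gt k t with hk | hk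
  · obtain ⟨j, rfl⟩ := Nat.exists_eq_add_of_le hk
    rw [← h.redBefore_le_iff]; omega
  · constructor <;> intro <;> omega

lemma Bl_add_redBefore (h : U.BlueUnbounded ω) (k : ℕ) :
    U.Bl (k + U.redBefore k ω) ω = k := by
  set T := k + U.redBefore k ω with hT
  have h1 := (h.add_redBefore_le_iff k T).1 le_rfl
  rcases Nat.eq_zero_or_pos T with h0 | h0
  · rw [h0, U.init_Bl] at h1 ⊢; omega
  · have h2 : ¬ k ≤ U.Bl (T - 1) ω := by rw [← h.add_redBefore_le_iff]; omega
    have h3 := U.step (T - 1) ω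
    rw [Nat.sub_add_cancel h0] at h3
    omega

lemma tau_eq (h : U.BlueUnbounded ω) (k : ℕ) : U.tau k ω = k + U.redBefore k ω := by
  induction k with
  | zero =>
    have := (h.add_redBefore_le_iff 0 0).2 (Nat.zero_le _)
    simp only [tau]; omega
  | succ k ih =>
    have hk := h.add_redBefore_le_iff k
    have hk1 := h.add_redBefore_le_iff (k + 1)
    have hB := h.Bl_add_redBefore (k + 1)
    simp only [tau]
    rw [ih]
    set T := k + 1 + U.redBefore (k + 1) ω with hT
    have h2 : ¬ k + 1 ≤ U.Bl (T - 1) ω := by rw [← hk1]; omega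
    have h3 := U.step (T - 1) ω
    rw [Nat.sub_add_cancel (by omega : 1 ≤ T)] at h3
    have hmem : T ∈ {n : ℕ | k + U.redBefore k ω < n ∧ U.Bl n ω = U.Bl (n - 1) ω + 1} := by
      have h4 := (hk (T - 1)).2 (by omega)
      exact ⟨by omega, by omega⟩
    refine le_antisymm (Nat.sInf_le hmem) (le_csInf ⟨T, hmem⟩ ?_)
    rintro n ⟨hn1, hn2⟩
    have h5 := (hk (n - 1)).1 (by omega)
    exact (hk1 n).2 (by omega)

lemma D_tau (h : U.BlueUnbounded ω) (k : ℕ) :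
    (U.D (U.tau k ω) ω : ℝ) = (U.redBefore k ω : ℝ) - k := by
  have h1 := h.Bl_add_redBefore k
  have h2 := U.Bl_add_Re (k + U.redBefore k ω) ω
  rw [h.tau_eq, D, h1, show U.Re (k + U.redBefore k ω) ω = U.redBefore k ω by omega]
  push_cast; ring

lemma redBefore_mono (h : U.BlueUnbounded ω) : Monotone fun k => U.redBefore k ω := by
  refine monotone_nat_of_le_succ fun k => ?_
  rw [h.redBefore_le_iff]
  have h1 := h.Bl_add_redBefore (k + 1)
  have := U.step (k + U.redBefore (k + 1) ω) ω
  rw [show k + U.redBefore (k + 1) ω + 1 = k + 1 + U.redBefore (k + 1) ω by ring] at this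
  omega

lemma redBefore_succ_eq_iff (h : U.BlueUnbounded ω) (k j : ℕ) :
    U.redBefore (k + 1) ω = j ↔
      U.Bl (k + j) ω = k ∧ U.Bl (k + j + 1) ω = U.Bl (k + j) ω + 1 := by
  have h1 := h.add_redBefore_le_iff (k + 1) (k + j + 1)
  have h2 := h.add_redBefore_le_iff (k + 1) (k + j)
  have := U.step (k + j) ω
  omega

lemma redBefore_le_lt_iff (h : U.BlueUnbounded ω) (k j : ℕ) :
    U.redBefore k ω ≤ j ∧ j < U.redBefore (k + 1) ω ↔
      U.Bl (k + j) ω = k ∧ U.Bl (k + j + 1) ω = U.Bl (k + j) ω := by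
  have h1 := h.add_redBefore_le_iff (k + 1) (k + j + 1)
  have h2 := h.add_redBefore_le_iff k (k + j)
  have := U.step (k + j) ω
  omega

lemma redBefore_eq_iff (h : U.BlueUnbounded ω) (k y : ℕ) :
    U.redBefore k ω = y ↔ k ≤ U.Bl (k + y) ω ∧ ∀ i < y, ¬ k ≤ U.Bl (k + i) ω := by
  simp only [← h.redBefore_le_iff]
  constructor
  · rintro rfl; exact ⟨le_rfl, fun i hi => by omega⟩
  · rintro ⟨h1, h2⟩
    by_contra hne
    exact h2 _ (by omega) le_rfl

end BlueUnbounded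

lemma measurable_redBefore (k : ℕ) : Measurable (U.redBefore k) := by
  refine measurable_to_countable' fun y => ?_
  have hm : ∀ i, MeasurableSet {ω | k ≤ U.Bl (k + i) ω} := fun i =>
    U.meas_Bl _ measurableSet_Ici
  have : U.redBefore k ⁻¹' {y} =
      ({ω | k ≤ U.Bl (k + y) ω} ∩ ⋂ i, ⋂ (_ : i < y), {ω | k ≤ U.Bl (k + i) ω}ᶜ) ∪
        ((⋂ i, {ω | k ≤ U.Bl (k + i) ω}ᶜ) ∩ {_ω | y = 0}) := by
    ext ω
    simp only [redBefore, Set.mem_preimage, Set.mem_singleton_iff, Set.mem_union, Set.mem_inter_iff,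
      Set.mem_ofPred_eq, Set.mem_iInter, Set.mem_compl_iff]
    rcases Set.eq_empty_or_nonempty {j | k ≤ U.Bl (k + j) ω} with he | hne
    · rw [he, Nat.sInf_empty]
      have h : ∀ i, ¬ k ≤ U.Bl (k + i) ω := fun i => Set.eq_empty_iff_forall_notMem.1 he i
      constructor
      · rintro rfl; exact Or.inr ⟨h, rfl⟩
      · rintro (h1 | h1)
        · exact absurd h1.1 (h y)
        · exact h1.2.symm
    · constructor
      · rintro rfl
        exact Or.inl ⟨Nat.sInf_mem hne, fun i hi h => absurd (Nat.sInf_le (s := {j | k ≤ U.Bl (k + j) ω}) h) hi.not_ge⟩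
      · rintro (h1 | h1)
        · refine le_antisymm (Nat.sInf_le h1.1) (le_csInf hne fun i hi => ?_)
          by_contra hlt
          exact h1.2 i (by omega) hi
        · obtain ⟨j, hj⟩ := hne
          exact absurd hj (h1.1 j)
  rw [this]
  refine MeasurableSet.union ((hm y).inter (MeasurableSet.iInter fun i => MeasurableSet.iInter
    fun _ => (hm i).compl)) ((MeasurableSet.iInter fun i => (hm i).compl).inter
    (MeasurableSet.const _))

lemma F_le (n : ℕ) : U.F n ≤ ‹MeasurableSpace Ω› :=
  iSup₂_le fun j _ => ((U.meas_Bl j).prodMk (U.meas_Re j)).comap_le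

lemma measurable_Bl_F {j n : ℕ} (h : j ≤ n) : Measurable[U.F n] (U.Bl j) := by
  have h1 : Measurable[MeasurableSpace.comap (fun ω => (U.Bl j ω, U.Re j ω)) inferInstance]
      (fun ω => (U.Bl j ω, U.Re j ω)) := comap_measurable _
  have h2 := measurable_fst.comp h1
  exact h2.mono (le_iSup₂_of_le (f := fun j (_ : j ∈ Set.Iic n) => MeasurableSpace.comap
    (fun ω => (U.Bl j ω, U.Re j ω)) inferInstance) j h le_rfl) le_rfl

/-- Balance between a blue and a red draw from the state `(i, j)`, conditionally on the past. -/
lemma step_balance [IsProbabilityMeasure μ] (hb : ∀ i, 0 < b i) (hr : ∀ i, 0 < r i)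
    {t i j : ℕ} {S : Set Ω} (hS : MeasurableSet[U.F t] S)
    (hSs : ∀ ω ∈ S, U.Bl t ω = i ∧ U.Re t ω = j) :
    r j * μ.real (S ∩ {ω | U.Bl (t + 1) ω = U.Bl t ω + 1}) =
      b i * μ.real (S ∩ {ω | U.Bl (t + 1) ω = U.Bl t ω}) := by
  have hSm : MeasurableSet S := U.F_le t _ hS
  have hblue : MeasurableSet {ω | U.Bl (t + 1) ω = U.Bl t ω + 1} :=
    measurableSet_eq_fun (U.meas_Bl _) ((U.meas_Bl t).add_const 1)
  have hind : (fun ω => if U.Bl (t + 1) ω = U.Bl t ω + 1 then (1:ℝ) else 0) =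
      Set.indicator {ω | U.Bl (t + 1) ω = U.Bl t ω + 1} (fun _ => 1) := by
    ext ω; simp [Set.indicator_apply]
  have hint : Integrable (fun ω => if U.Bl (t + 1) ω = U.Bl t ω + 1 then (1:ℝ) else 0) μ := by
    rw [hind]; exact (integrable_const _).indicator hblue
  have h1 := setIntegral_condExp (U.F_le t) hint hS
  have h2 : ∫ ω in S, (μ[(fun ω => if U.Bl (t + 1) ω = U.Bl t ω + 1 then (1:ℝ) else 0) | U.F t]) ω ∂μ
      = ∫ _ω in S, b i / (b i + r j) ∂μ := by
    refine setIntegral_congr_ae hSm ?_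
    filter_upwards [U.markov t] with ω hω hωS
    rw [F, hω, (hSs ω hωS).1, (hSs ω hωS).2]
  rw [h2, hind, setIntegral_indicator hblue, setIntegral_const, setIntegral_const] at h1
  simp only [smul_eq_mul, mul_one] at h1
  have h3 : S ∩ {ω | U.Bl (t + 1) ω = U.Bl t ω} =
      S \ (S ∩ {ω | U.Bl (t + 1) ω = U.Bl t ω + 1}) := by
    ext ω
    have := U.step t ω
    simp only [Set.mem_inter_iff, Set.mem_ofPred_eq, Set.mem_sdiff]
    constructor
    · rintro ⟨h, h'⟩; exact ⟨h, by omega⟩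
    · rintro ⟨h, h'⟩; exact ⟨h, by have : ¬ _ := fun h'' => h' ⟨h, h''⟩; omega⟩
  rw [h3, measureReal_sdiff Set.inter_subset_left (hSm.inter hblue), ← h1]
  have := hb i
  have := hr j
  field_simp
  ring

lemma ae_blueUnbounded [IsProbabilityMeasure μ] (hb : ∀ i, 0 < b i) (hr : ∀ i, 0 < r i)
    (hr0 : Tendsto r atTop (nhds 0)) : ∀ᵐ ω ∂μ, U.BlueUnbounded ω := by
  have hnull : ∀ k J : ℕ, μ.real {ω | ∀ j, J ≤ j → U.Bl (k + j) ω = k} = 0 := by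
    intro k J
    refine le_antisymm ?_ measureReal_nonneg
    have hlim : Tendsto (fun j => r j / b k) atTop (nhds 0) := by
      simpa using hr0.div_const (b k)
    refine ge_of_tendsto hlim ?_
    filter_upwards [eventually_ge_atTop J] with j hj
    have hS : MeasurableSet[U.F (k + j)] {ω | U.Bl (k + j) ω = k} :=
      measurable_Bl_F le_rfl (measurableSet_singleton k)
    have hbal := step_balance (i := k) (j := j) hb hr hS fun ω (hω : U.Bl (k + j) ω = k) =>
      ⟨hω, by have := U.Bl_add_Re (k + j) ω; omega⟩
    rw [le_div_iff₀ (hb k), mul_comm]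
    calc _ ≤ b k * μ.real ({ω | U.Bl (k + j) ω = k} ∩
          {ω | U.Bl (k + j + 1) ω = U.Bl (k + j) ω}) := by
          refine mul_le_mul_of_nonneg_left (measureReal_mono fun ω hω => ?_) (hb k).le
          exact ⟨hω j hj, (hω (j + 1) (by omega)).trans (hω j hj).symm⟩
      _ ≤ r j := by
          rw [← hbal]
          exact mul_le_of_le_one_right (hr j).le measureReal_le_one
  have hall : ∀ᵐ ω ∂μ, ∀ k J : ℕ, ¬ ∀ j, J ≤ j → U.Bl (k + j) ω = k := by
    rw [ae_all_iff]; intro k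
    rw [ae_all_iff]; intro J
    rw [ae_iff]
    simpa [measureReal_eq_zero_iff] using hnull k J
  filter_upwards [hall] with ω hω
  intro k
  by_contra hk
  push Not at hk
  induction k with
  | zero => exact absurd (hk 0) (by omega)
  | succ k ih =>
    by_cases h : ∃ t, k ≤ U.Bl t ω
    · obtain ⟨t, ht⟩ := h
      refine hω k t fun j hj => le_antisymm (by have := hk (k + j); omega)
        (ht.trans (U.Bl_mono ω (by omega)))
    · push Not at h
      exact ih h

/-- A process `X` with nondecreasing trajectories started at `0` whose transitions balance the
rates `b` and `r`: given `X k ≤ j`, it passes `j` or stops at `j` with odds `r j : b k`. -/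
structure _root_.BalancedChain (μ : Measure Ω) (b r : ℕ → ℝ) (X : ℕ → Ω → ℕ) : Prop where
  meas : ∀ k, Measurable (X k)
  zero : ∀ᵐ ω ∂μ, X 0 ω = 0
  mono : ∀ᵐ ω ∂μ, Monotone fun k => X k ω
  balance : ∀ n k, n ≤ k → ∀ y j, r j * μ.real {ω | X n ω = y ∧ X (k + 1) ω = j} =
    b k * μ.real {ω | X n ω = y ∧ X k ω ≤ j ∧ j < X (k + 1) ω}

lemma balancedChain [IsProbabilityMeasure μ] (hb : ∀ i, 0 < b i) (hr : ∀ i, 0 < r i)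
    (hr0 : Tendsto r atTop (nhds 0)) : BalancedChain μ b r U.redBefore where
  meas := measurable_redBefore
  zero := by
    filter_upwards [ae_blueUnbounded (U := U) hb hr hr0] with ω h
    have := (h.add_redBefore_le_iff 0 0).2 (Nat.zero_le _)
    omega
  mono := by
    filter_upwards [ae_blueUnbounded (U := U) hb hr hr0] with ω h
    exact h.redBefore_mono
  balance := by
    intro n k hnk y j
    have hgood := ae_blueUnbounded (U := U) hb hr hr0
    set V : Set Ω := {ω | n ≤ U.Bl (n + y) ω ∧ ∀ i < y, ¬ n ≤ U.Bl (n + i) ω} with hV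
    set S : Set Ω := {ω | V ω ∧ U.Bl (k + j) ω = k} with hS
    have e1 : {ω | U.redBefore n ω = y ∧ U.redBefore (k + 1) ω = j} =ᵐ[μ]
        (S ∩ {ω | U.Bl (k + j + 1) ω = U.Bl (k + j) ω + 1} : Set Ω) := by
      filter_upwards [hgood] with ω h
      refine propext ?_
      change U.redBefore n ω = y ∧ U.redBefore (k + 1) ω = j ↔ ((n ≤ U.Bl (n + y) ω ∧
        ∀ i < y, ¬ n ≤ U.Bl (n + i) ω) ∧ U.Bl (k + j) ω = k) ∧
        U.Bl (k + j + 1) ω = U.Bl (k + j) ω + 1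
      rw [h.redBefore_succ_eq_iff, h.redBefore_eq_iff]; tauto
    have e2 : {ω | U.redBefore n ω = y ∧ U.redBefore k ω ≤ j ∧ j < U.redBefore (k + 1) ω} =ᵐ[μ]
        (S ∩ {ω | U.Bl (k + j + 1) ω = U.Bl (k + j) ω} : Set Ω) := by
      filter_upwards [hgood] with ω h
      refine propext ?_
      change U.redBefore n ω = y ∧ U.redBefore k ω ≤ j ∧ j < U.redBefore (k + 1) ω ↔
        ((n ≤ U.Bl (n + y) ω ∧
        ∀ i < y, ¬ n ≤ U.Bl (n + i) ω) ∧ U.Bl (k + j) ω = k) ∧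
        U.Bl (k + j + 1) ω = U.Bl (k + j) ω
      rw [h.redBefore_le_lt_iff, h.redBefore_eq_iff]; tauto
    rcases le_or_gt y j with hy | hy
    · rw [measureReal_congr e1, measureReal_congr e2]
      refine step_balance hb hr ?_ fun ω hω => ⟨hω.2, ?_⟩
      · have hm : ∀ i ≤ y, MeasurableSet[U.F (k + j)] {ω | n ≤ U.Bl (n + i) ω} := fun i hi =>
          measurable_Bl_F (by omega) measurableSet_Ici
        have : S = ({ω | n ≤ U.Bl (n + y) ω} ∩ ⋂ i, ⋂ (_ : i < y), {ω | n ≤ U.Bl (n + i) ω}ᶜ) ∩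
            {ω | U.Bl (k + j) ω = k} := by
          ext ω
          simp only [Set.mem_inter_iff, Set.mem_iInter, Set.mem_compl_iff, Set.mem_ofPred_eq]
          rfl
        rw [this]
        refine MeasurableSet.inter (MeasurableSet.inter (hm y le_rfl) (MeasurableSet.iInter
          fun i => MeasurableSet.iInter fun hi => (hm i hi.le).compl)) ?_
        exact measurable_Bl_F le_rfl (measurableSet_singleton k)
      · have := U.Bl_add_Re (k + j) ω
        have := hω.2
        omega
    · have z1 : {ω | U.redBefore n ω = y ∧ U.redBefore (k + 1) ω = j} =ᵐ[μ] (∅ : Set Ω) := by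
        filter_upwards [hgood] with ω h
        have h1 := h.redBefore_mono (show n ≤ k + 1 by omega)
        refine propext ⟨fun h2 => ?_, False.elim⟩
        have h3 : U.redBefore n ω = y ∧ U.redBefore (k + 1) ω = j := h2
        simp only at h1
        omega
      have z2 : {ω | U.redBefore n ω = y ∧ U.redBefore k ω ≤ j ∧ j < U.redBefore (k + 1) ω}
          =ᵐ[μ] (∅ : Set Ω) := by
        filter_upwards [hgood] with ω h
        have h1 := h.redBefore_mono hnk
        refine propext ⟨fun h2 => ?_, False.elim⟩
        have h3 : U.redBefore n ω = y ∧ U.redBefore k ω ≤ j ∧ j < U.redBefore (k + 1) ω := h2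
        simp only at h1
        omega
      rw [measureReal_congr z1, measureReal_congr z2]; simp

end Urn

namespace BalancedChain

variable {Ω : Type*} [MeasurableSpace Ω] {μ : Measure Ω} [IsProbabilityMeasure μ]
  {b r : ℕ → ℝ} {X : ℕ → Ω → ℕ}

/-- The discrete generator identity: `b k * E[f(Xₙ) (F(Xₖ₊₁) - F(Xₖ))]` equals
`E[f(Xₙ) r(Xₖ₊₁) (F(Xₖ₊₁ + 1) - F(Xₖ₊₁))]` for `n ≤ k`. -/
lemma integral_mul_sub (h : BalancedChain μ b r X) (hb : ∀ i, 0 < b i) (hr : ∀ i, 0 < r i)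
    {n k : ℕ} (hnk : n ≤ k) (f F : ℕ → ℝ)
    (hint : Integrable (fun ω => f (X n ω) *
      ((F (X (k + 1) ω + 1) - F (X (k + 1) ω)) * r (X (k + 1) ω))) μ) :
    b k * ∫ ω, f (X n ω) * (F (X (k + 1) ω) - F (X k ω)) ∂μ =
      ∫ ω, f (X n ω) * ((F (X (k + 1) ω + 1) - F (X (k + 1) ω)) * r (X (k + 1) ω)) ∂μ := by
  set c : ℕ × ℕ → ℝ := fun p => f p.1 * (F (p.2 + 1) - F p.2) with hc
  set A : ℕ × ℕ → Set Ω := fun p => {ω | X n ω = p.1 ∧ X k ω ≤ p.2 ∧ p.2 < X (k + 1) ω} with hA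
  set S : ℕ × ℕ → Set Ω := fun p => {ω | X n ω = p.1 ∧ X (k + 1) ω = p.2} with hS
  have hX := h.meas
  have hAm : ∀ p, MeasurableSet (A p) := fun p =>
    (hX n (measurableSet_singleton p.1)).inter
      ((hX k measurableSet_Iic).inter (hX (k + 1) measurableSet_Ioi))
  have hSm : ∀ p, MeasurableSet (S p) := fun p =>
    (hX n (measurableSet_singleton p.1)).inter (hX (k + 1) (measurableSet_singleton p.2))
  have hbal : ∀ p, r p.2 * μ.real (S p) = b k * μ.real (A p) := fun p =>
    h.balance n k hnk p.1 p.2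
  set T₁ : ℕ × ℕ → Ω → ℝ := fun p => (A p).indicator fun _ => c p with hT₁
  set T₂ : ℕ × ℕ → Ω → ℝ := fun p => (S p).indicator fun _ => c p * r p.2 with hT₂
  have hT₁m : ∀ p, AEStronglyMeasurable (T₁ p) μ := fun p =>
    (stronglyMeasurable_const.indicator (hAm p)).aestronglyMeasurable
  have hT₂m : ∀ p, AEStronglyMeasurable (T₂ p) μ := fun p =>
    (stronglyMeasurable_const.indicator (hSm p)).aestronglyMeasurable
  have hT₂z : ∀ ω, ∀ p, p ≠ (X n ω, X (k + 1) ω) → T₂ p ω = 0 := by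
    intro ω p hp
    refine Set.indicator_of_notMem (fun hm => hp ?_) _
    exact Prod.ext hm.1.symm hm.2.symm
  have hT₂s : ∀ ω, T₂ (X n ω, X (k + 1) ω) ω =
      f (X n ω) * ((F (X (k + 1) ω + 1) - F (X (k + 1) ω)) * r (X (k + 1) ω)) := by
    intro ω
    have : ω ∈ S (X n ω, X (k + 1) ω) := ⟨rfl, rfl⟩
    simp only [hT₂, Set.indicator_of_mem this, hc]; ring
  have hsum₂ : ∑' p, ∫⁻ ω, ‖T₂ p ω‖ₑ ∂μ ≠ ⊤ := by
    rw [← lintegral_tsum fun p => (hT₂m p).enorm]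
    convert hint.2.ne using 1
    refine lintegral_congr fun ω => ?_
    rw [tsum_eq_single (X n ω, X (k + 1) ω), hT₂s]
    intro p hp; simp [hT₂z ω p hp]
  have hl₁ : ∀ p, ∫⁻ ω, ‖T₁ p ω‖ₑ ∂μ = ‖c p‖ₑ * μ (A p) := by
    intro p
    simp only [hT₁, enorm_indicator_eq_indicator_enorm]
    rw [lintegral_indicator (hAm p), setLIntegral_const]
  have hl₂ : ∀ p, ∫⁻ ω, ‖T₂ p ω‖ₑ ∂μ = ‖c p‖ₑ * ENNReal.ofReal (r p.2) * μ (S p) := by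
    intro p
    simp only [hT₂, enorm_indicator_eq_indicator_enorm]
    rw [lintegral_indicator (hSm p), setLIntegral_const, enorm_mul, Real.enorm_of_nonneg (hr _).le]
  have hrel : ∀ p, ENNReal.ofReal (b k) * μ (A p) = ENNReal.ofReal (r p.2) * μ (S p) := by
    intro p
    have := hbal p
    rw [← ofReal_measureReal, ← ofReal_measureReal, ← ENNReal.ofReal_mul (hb k).le,
      ← ENNReal.ofReal_mul (hr _).le, this]
  have hsum₁ : ∑' p, ∫⁻ ω, ‖T₁ p ω‖ₑ ∂μ ≠ ⊤ := by
    intro htop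
    apply hsum₂
    have : ∑' p, ∫⁻ ω, ‖T₂ p ω‖ₑ ∂μ = ENNReal.ofReal (b k) * ∑' p, ∫⁻ ω, ‖T₁ p ω‖ₑ ∂μ := by
      rw [← ENNReal.tsum_mul_left]
      refine tsum_congr fun p => ?_
      rw [hl₁, hl₂, mul_assoc, ← hrel]; ring
    rw [this, htop, ENNReal.mul_top]
    simpa using hb k
  have hi₁ : ∫ ω, f (X n ω) * (F (X (k + 1) ω) - F (X k ω)) ∂μ = ∑' p, ∫ ω, T₁ p ω ∂μ := by
    rw [← integral_tsum hT₁m hsum₁]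
    refine integral_congr_ae ?_
    filter_upwards [h.mono] with ω hω
    have hle : X k ω ≤ X (k + 1) ω := hω (Nat.le_succ k)
    rw [tsum_eq_sum (s := {X n ω} ×ˢ Finset.Ico (X k ω) (X (k + 1) ω)), Finset.sum_product,
      Finset.sum_singleton, ← Finset.sum_Ico_sub F hle, Finset.mul_sum]
    · refine Finset.sum_congr rfl fun j hj => ?_
      rw [Finset.mem_Ico] at hj
      have : ω ∈ A (X n ω, j) := ⟨rfl, hj⟩
      simp only [hT₁, Set.indicator_of_mem this, hc]
    · intro p hp
      refine Set.indicator_of_notMem (fun hm => hp ?_) _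
      rw [Finset.mem_product, Finset.mem_singleton, Finset.mem_Ico]
      exact ⟨hm.1.symm, hm.2⟩
  have hi₂ : ∫ ω, f (X n ω) * ((F (X (k + 1) ω + 1) - F (X (k + 1) ω)) * r (X (k + 1) ω)) ∂μ =
      ∑' p, ∫ ω, T₂ p ω ∂μ := by
    rw [← integral_tsum hT₂m hsum₂]
    refine integral_congr_ae (Eventually.of_forall fun ω => ?_)
    simp only
    rw [tsum_eq_single (X n ω, X (k + 1) ω) (hT₂z ω), hT₂s]
  rw [hi₁, hi₂, ← tsum_mul_left]
  refine tsum_congr fun p => ?_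
  simp only [hT₁, hT₂]
  rw [integral_indicator_const _ (hAm p), integral_indicator_const _ (hSm p), smul_eq_mul,
    smul_eq_mul]
  linear_combination (-c p) * hbal p

/-- Trajectories have exponential moments of all orders when the rate `r` vanishes at infinity. -/
lemma integrable_exp (h : BalancedChain μ b r X) (hb : ∀ i, 0 < b i) (hr : ∀ i, 0 < r i)
    (hr0 : Tendsto r atTop (nhds 0)) {θ : ℝ} (hθ : 0 < θ) (k : ℕ) :
    Integrable (fun ω => Real.exp (θ * X k ω)) μ := by
  have hmeas : ∀ k, AEStronglyMeasurable (fun ω => Real.exp (θ * X k ω)) μ := fun k =>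
    ((measurable_of_countable fun j : ℕ => Real.exp (θ * j)).comp
      (h.meas k)).aestronglyMeasurable
  induction k with
  | zero =>
    refine (integrable_const (1:ℝ)).congr ?_
    filter_upwards [h.zero] with ω hω
    simp [hω]
  | succ k ih =>
    obtain ⟨R, hR⟩ : ∃ R, ∀ j, r j ≤ R := by
      obtain ⟨R, hR⟩ := hr0.bddAbove_range
      exact ⟨R, fun j => hR ⟨j, rfl⟩⟩
    have hE : 0 < Real.exp θ - 1 := by linarith [Real.add_one_le_exp θ]
    obtain ⟨J, hJ⟩ := eventually_atTop.1
      (hr0.eventually (eventually_le_nhds (show (0:ℝ) < b k / (2 * (Real.exp θ - 1)) by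
        have := hb k; positivity)))
    set G : ℕ → ℕ → ℝ := fun M j => Real.exp (θ * (min j M : ℕ)) with hG
    set K : ℝ := (Real.exp θ - 1) * Real.exp (θ * J) * R with hK
    have hR0 : 0 < R := (hr 0).trans_le (hR 0)
    have hK0 : 0 ≤ K := by positivity
    have hGb : ∀ M j, G M j ≤ Real.exp (θ * M) := fun M j => by
      simp only [hG]; gcongr; exact min_le_right _ _
    have hG0 : ∀ M j, 0 < G M j := fun M j => Real.exp_pos _
    have hGX : ∀ M j, G M j ≤ Real.exp (θ * j) := fun M j => by
      simp only [hG]; gcongr; exact min_le_left _ _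
    have hmG : ∀ M k, AEStronglyMeasurable (fun ω => G M (X k ω)) μ := fun M k =>
      ((measurable_of_countable (G M)).comp (h.meas k)).aestronglyMeasurable
    have hGi : ∀ M k, Integrable (fun ω => G M (X k ω)) μ := fun M k =>
      Integrable.of_bound (hmG M k) (Real.exp (θ * M)) (Eventually.of_forall fun ω => by
        rw [Real.norm_of_nonneg (hG0 _ _).le]; exact hGb _ _)
    have hd0 : ∀ M j, 0 ≤ G M (j + 1) - G M j := fun M j => by
      rw [sub_nonneg]; simp only [hG]; gcongr; omega
    have hd1 : ∀ M j, G M (j + 1) - G M j ≤ (Real.exp θ - 1) * G M j := fun M j => by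
      have : G M (j + 1) ≤ Real.exp θ * G M j := by
        simp only [hG, ← Real.exp_add]
        have h1 : ((min (j + 1) M : ℕ) : ℝ) ≤ (min j M : ℕ) + 1 := by
          exact_mod_cast (by omega)
        gcongr; nlinarith
      linarith
    have hdr : ∀ M j, (G M (j + 1) - G M j) * r j ≤ b k / 2 * G M j + K := by
      intro M j
      rcases le_or_gt J j with hj | hj
      · have h1 := hJ j hj
        rw [le_div_iff₀ (by positivity)] at h1
        have h2 := mul_le_mul_of_nonneg_right (hd1 M j) (hr j).le
        nlinarith [hG0 M j]
      · have h1 : G M j ≤ Real.exp (θ * J) := (hGX M j).trans (by gcongr)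
        calc (G M (j + 1) - G M j) * r j ≤ ((Real.exp θ - 1) * Real.exp (θ * J)) * R :=
              mul_le_mul ((hd1 M j).trans (by gcongr)) (hR j) (hr j).le (by positivity)
          _ ≤ _ := by have := hb k; have := hG0 M j; rw [← hK]; nlinarith
    have hbound : ∀ M, ∫ ω, G M (X (k + 1) ω) ∂μ ≤
        2 * (∫ ω, Real.exp (θ * X k ω) ∂μ + K / b k) := by
      intro M
      have hi : Integrable (fun ω => (1:ℝ) *
          ((G M (X (k + 1) ω + 1) - G M (X (k + 1) ω)) * r (X (k + 1) ω))) μ := by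
        refine Integrable.of_bound ((measurable_of_countable fun j : ℕ =>
          (1:ℝ) * ((G M (j + 1) - G M j) * r j)).comp (h.meas (k + 1))).aestronglyMeasurable
          (b k / 2 * Real.exp (θ * M) + K) (Eventually.of_forall fun ω => ?_)
        rw [one_mul, Real.norm_of_nonneg (mul_nonneg (hd0 _ _) (hr _).le)]
        refine (hdr _ _).trans ?_
        have := hb k
        gcongr
        exact hGb _ _
      have hid := h.integral_mul_sub hb hr (Nat.zero_le k) (fun _ => 1) (G M) hi
      simp only [one_mul] at hid hi
      rw [integral_sub (hGi _ _) (hGi _ _)] at hid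
      have h1 : ∫ ω, (G M (X (k + 1) ω + 1) - G M (X (k + 1) ω)) * r (X (k + 1) ω) ∂μ ≤
          b k / 2 * ∫ ω, G M (X (k + 1) ω) ∂μ + K := by
        calc _ ≤ ∫ ω, (b k / 2 * G M (X (k + 1) ω) + K) ∂μ :=
              integral_mono hi (((hGi M (k + 1)).const_mul _).add (integrable_const _))
                fun ω => hdr M _
          _ = _ := by
              rw [integral_add ((hGi M (k + 1)).const_mul _) (integrable_const _),
                integral_const_mul]
              simp
      have h2 : ∫ ω, G M (X k ω) ∂μ ≤ ∫ ω, Real.exp (θ * X k ω) ∂μ :=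
        integral_mono (hGi M k) ih fun ω => hGX M _
      have hbk := hb k
      have h3 : b k * ∫ ω, G M (X (k + 1) ω) ∂μ ≤
          b k * (2 * (∫ ω, Real.exp (θ * X k ω) ∂μ + K / b k)) := by
        have : b k * (2 * (∫ ω, Real.exp (θ * X k ω) ∂μ + K / b k)) =
          2 * (b k * ∫ ω, Real.exp (θ * X k ω) ∂μ) + 2 * K := by field_simp
        rw [this]
        nlinarith [mul_le_mul_of_nonneg_left h2 hbk.le]
      exact le_of_mul_le_mul_left h3 hbk
    refine ⟨hmeas _, ?_⟩
    have hlim : ∀ ω, Tendsto (fun M => ‖G M (X (k + 1) ω)‖ₑ) atTop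
        (nhds ‖Real.exp (θ * X (k + 1) ω)‖ₑ) := by
      intro ω
      refine tendsto_const_nhds.congr' ?_
      filter_upwards [eventually_ge_atTop (X (k + 1) ω)] with M hM
      simp only [hG, min_eq_left hM]
    have hfat := lintegral_liminf_le' (μ := μ) (u := atTop) (f := fun M ω => ‖G M (X (k + 1) ω)‖ₑ)
      (fun M => (hmG M (k + 1)).enorm)
    simp only [(hlim _).liminf_eq] at hfat
    refine hfat.trans_lt ?_
    refine lt_of_le_of_lt (liminf_le_of_le (by isBoundedDefault)
      (a := ENNReal.ofReal (2 * (∫ ω, Real.exp (θ * X k ω) ∂μ + K / b k))) ?_)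
      ENNReal.ofReal_lt_top
    intro a ha
    obtain ⟨M, hM⟩ := ha.exists
    refine hM.trans ?_
    have : ∫⁻ ω, ‖G M (X (k + 1) ω)‖ₑ ∂μ = ENNReal.ofReal (∫ ω, G M (X (k + 1) ω) ∂μ) := by
      rw [ofReal_integral_eq_lintegral_ofReal (hGi M (k + 1))
        (Eventually.of_forall fun ω => (hG0 _ _).le)]
      exact lintegral_congr fun ω => Real.enorm_of_nonneg (hG0 _ _).le
    rw [this]
    exact ENNReal.ofReal_le_ofReal (hbound M)

end BalancedChain

lemma cosh_le_exp_abs (x : ℝ) : Real.cosh x ≤ Real.exp |x| := by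
  rw [← Real.cosh_abs, Real.cosh_eq]
  have := Real.exp_le_exp.2 (neg_le_self (abs_nonneg x))
  linarith

/-- Sequences of at most exponential growth. -/
def ExpBounded (f : ℕ → ℝ) : Prop :=
  ∃ C θ : ℝ, 0 ≤ C ∧ 0 < θ ∧ ∀ j : ℕ, |f j| ≤ C * Real.exp (θ * j)

namespace ExpBounded

variable {f g : ℕ → ℝ}

lemma of_le (hg : ExpBounded g) (h : ∀ j, |f j| ≤ |g j|) : ExpBounded f := by
  obtain ⟨C, θ, hC, hθ, hg⟩ := hg
  exact ⟨C, θ, hC, hθ, fun j => (h j).trans (hg j)⟩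

lemma const (c : ℝ) : ExpBounded fun _ => c :=
  ⟨|c|, 1, abs_nonneg _, one_pos, fun j => le_mul_of_one_le_right (abs_nonneg _)
    (Real.one_le_exp (by positivity))⟩

lemma natCast : ExpBounded fun j => (j : ℝ) :=
  ⟨1, 1, zero_le_one, one_pos, fun j => by
    rw [Nat.abs_cast, one_mul, one_mul]; linarith [Real.add_one_le_exp (j : ℝ)]⟩

lemma add (hf : ExpBounded f) (hg : ExpBounded g) : ExpBounded fun j => f j + g j := by
  obtain ⟨C, θ, hC, hθ, hf⟩ := hf
  obtain ⟨C', θ', hC', hθ', hg⟩ := hg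
  refine ⟨C + C', θ + θ', by positivity, by positivity, fun j => ?_⟩
  calc |f j + g j| ≤ C * Real.exp (θ * j) + C' * Real.exp (θ' * j) :=
        (abs_add_le _ _).trans (add_le_add (hf j) (hg j))
    _ ≤ C * Real.exp ((θ + θ') * j) + C' * Real.exp ((θ + θ') * j) := by
        gcongr <;> linarith
    _ = _ := by ring

lemma mul (hf : ExpBounded f) (hg : ExpBounded g) : ExpBounded fun j => f j * g j := by
  obtain ⟨C, θ, hC, hθ, hf⟩ := hf
  obtain ⟨C', θ', hC', hθ', hg⟩ := hg
  refine ⟨C * C', θ + θ', by positivity, by positivity, fun j => ?_⟩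
  rw [abs_mul, add_mul, Real.exp_add]
  calc |f j| * |g j| ≤ (C * Real.exp (θ * j)) * (C' * Real.exp (θ' * j)) :=
        mul_le_mul (hf j) (hg j) (abs_nonneg _) (by positivity)
    _ = _ := by ring

lemma neg (hf : ExpBounded f) : ExpBounded fun j => -f j :=
  hf.of_le fun j => by rw [abs_neg]

lemma sub (hf : ExpBounded f) (hg : ExpBounded g) : ExpBounded fun j => f j - g j := by
  simpa only [sub_eq_add_neg] using hf.add hg.neg

lemma abs (hf : ExpBounded f) : ExpBounded fun j => |f j| :=
  hf.of_le fun j => by rw [abs_abs]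

lemma succ (hf : ExpBounded f) : ExpBounded fun j => f (j + 1) := by
  obtain ⟨C, θ, hC, hθ, hf⟩ := hf
  refine ⟨C * Real.exp θ, θ, by positivity, hθ, fun j => (hf (j + 1)).trans_eq ?_⟩
  rw [mul_assoc, ← Real.exp_add]; push_cast; ring_nf

lemma exp_abs_sub {t : ℝ} (ht : 0 < t) (k : ℝ) :
    ExpBounded fun j => Real.exp (t * |(j : ℝ) - k|) := by
  refine ⟨Real.exp (t * |k|), t, by positivity, ht, fun j => ?_⟩
  rw [abs_of_pos (Real.exp_pos _), ← Real.exp_add, ← mul_add]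
  gcongr
  rw [add_comm]
  exact (abs_sub _ _).trans_eq (by rw [Nat.abs_cast])

lemma cosh_mul_sub {t : ℝ} (ht : 0 < t) (k : ℝ) :
    ExpBounded fun j => Real.cosh (t * ((j : ℝ) - k)) := by
  refine (exp_abs_sub ht k).of_le fun j => ?_
  rw [abs_of_pos (Real.cosh_pos _), abs_of_pos (Real.exp_pos _)]
  refine (cosh_le_exp_abs _).trans_eq ?_
  rw [abs_mul, abs_of_pos ht]

end ExpBounded

/-- One-step contraction inequality for the hyperbolic cosine. -/
lemma cosh_step {θ c u y : ℝ} (hθ : 0 < θ) (hθ1 : θ ≤ 1) (hc : 0 ≤ c)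
    (hy : 0 ≤ y ∧ u ≤ 1 + c ∨ y ≤ -1 ∧ 1 - c ≤ u) :
    Real.cosh (θ * (y - 1)) * (1 - 6 * θ ^ 2 - 18 * c * θ) ≤
      Real.cosh (θ * y) - u * (Real.cosh (θ * (y + 1)) - Real.cosh (θ * y)) := by
  have hch : Real.cosh θ ≤ 1 + θ ^ 2 := by
    refine (Real.cosh_le_exp_half_sq θ).trans ?_
    have h := Real.abs_exp_sub_one_le (x := θ ^ 2 / 2) (by rw [abs_of_nonneg (by positivity)]; nlinarith)
    rw [abs_of_nonneg (by positivity : 0 ≤ θ ^ 2 / 2)] at h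
    linarith [le_abs_self (Real.exp (θ ^ 2 / 2) - 1)]
  have hch1 : 1 ≤ Real.cosh θ := Real.one_le_cosh θ
  have hsh0 : 0 ≤ Real.sinh θ := Real.sinh_nonneg_iff.2 hθ.le
  have hsh : Real.sinh θ ≤ 2 * θ := by
    rw [Real.sinh_eq]
    have h := Real.abs_exp_sub_one_le (x := θ) (by rw [abs_of_pos hθ]; exact hθ1)
    rw [abs_of_pos hθ] at h
    linarith [le_abs_self (Real.exp θ - 1), Real.add_one_le_exp (-θ)]
  set z := θ * y with hz
  have hp : Real.cosh (θ * (y + 1)) = Real.cosh z * Real.cosh θ + Real.sinh z * Real.sinh θ := by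
    rw [← Real.cosh_add]; congr 1; ring
  have hm : Real.cosh (θ * (y - 1)) = Real.cosh z * Real.cosh θ - Real.sinh z * Real.sinh θ := by
    rw [← Real.cosh_sub]; congr 1; ring
  have hzs : |Real.sinh z| ≤ Real.cosh z := by
    rw [abs_le]
    constructor
    · have := Real.exp_pos z
      rw [← Real.cosh_add_sinh] at this; linarith
    · have := Real.exp_pos (-z)
      rw [← Real.cosh_sub_sinh] at this; linarith
  have hcz : 0 < Real.cosh z := Real.cosh_pos z
  have hcm : 0 < Real.cosh (θ * (y - 1)) := Real.cosh_pos _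
  have h3 : Real.cosh z ≤ 3 * Real.cosh (θ * (y - 1)) := by
    set v := θ * (y - 1) with hv
    have hvs : Real.sinh v ≤ Real.cosh v := by
      have := Real.exp_pos (-v)
      rw [← Real.cosh_sub_sinh] at this; linarith
    have : Real.cosh z = Real.cosh v * Real.cosh θ + Real.sinh v * Real.sinh θ := by
      rw [← Real.cosh_add]; congr 1; rw [hv, hz]; ring
    have he : Real.cosh θ + Real.sinh θ ≤ 3 := by
      rw [Real.cosh_add_sinh]
      have := Real.exp_one_lt_d9
      have := Real.exp_le_exp.2 hθ1
      linarith
    rw [this]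
    nlinarith [mul_le_mul_of_nonneg_right hvs hsh0]
  set δ := Real.cosh (θ * (y + 1)) - Real.cosh z with hδ
  have hδabs : |δ| ≤ 3 * θ * Real.cosh z := by
    have e : δ = Real.cosh z * (Real.cosh θ - 1) + Real.sinh z * Real.sinh θ := by
      rw [hδ, hp]; ring
    rw [e]
    refine (abs_add_le _ _).trans ?_
    rw [abs_mul, abs_mul, abs_of_pos hcz, abs_of_nonneg (sub_nonneg.2 hch1), abs_of_nonneg hsh0]
    have h1 : |Real.sinh z| * Real.sinh θ ≤ Real.cosh z * (2 * θ) :=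
      mul_le_mul hzs hsh hsh0 hcz.le
    have h2 : Real.cosh z * (Real.cosh θ - 1) ≤ Real.cosh z * θ :=
      mul_le_mul_of_nonneg_left (by nlinarith) hcz.le
    linarith
  have huδ : u * δ ≤ δ + c * |δ| := by
    rcases hy with ⟨hy, hu⟩ | ⟨hy, hu⟩
    · have : 0 ≤ δ := by
        rw [hδ, sub_nonneg, Real.cosh_le_cosh, abs_of_nonneg (by positivity),
          abs_of_nonneg (by positivity)]
        nlinarith
      rw [abs_of_nonneg this]; nlinarith
    · have : δ ≤ 0 := by
        rw [hδ, sub_nonpos, Real.cosh_le_cosh, abs_of_nonpos (by nlinarith),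
          abs_of_nonpos (by nlinarith)]
        nlinarith
      rw [abs_of_nonpos this]; nlinarith
  have hsum : Real.cosh z - δ = Real.cosh (θ * (y - 1)) - 2 * (Real.cosh θ - 1) * Real.cosh z := by
    rw [hδ, hp, hm]; ring
  have h5 : 2 * (Real.cosh θ - 1) * Real.cosh z ≤ 2 * θ ^ 2 * (3 * Real.cosh (θ * (y - 1))) := by
    apply mul_le_mul (by linarith) h3 hcz.le (by positivity)
  have h6 : c * |δ| ≤ c * (3 * θ * (3 * Real.cosh (θ * (y - 1)))) := by
    gcongr
    exact hδabs.trans (by gcongr)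
  nlinarith [mul_nonneg (mul_nonneg hc hθ.le) hcm.le]

namespace PowerSandwich

variable {α : ℝ} {q : ℕ} {b r : ℕ → ℝ}

lemma tendsto_rate (hα : 0 < α) (h : PowerSandwich α q fun i => (r i)⁻¹) :
    Tendsto r atTop (nhds 0) := by
  have h1 : Tendsto (fun j : ℕ => (2 * ((j - q : ℕ) : ℝ)) ^ α) atTop atTop :=
    (tendsto_rpow_atTop hα).comp
      ((tendsto_natCast_atTop_atTop.comp (tendsto_sub_atTop_nat q)).const_mul_atTop two_pos)
  have h2 : Tendsto (fun j => (r j)⁻¹) atTop atTop := tendsto_atTop_mono (fun j => (h j).1) h1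
  exact h2.inv_tendsto_atTop.congr fun j => inv_inv (r j)

/-- The ratio `r j / b k` is at most `1 + C / k` for `j ≥ k` and at least `1 - C / k` for
`j ≤ k`. -/
lemma exists_ratio_bound (hα : 0 < α) (hb : ∀ i, 0 < b i) (hr : ∀ i, 0 < r i)
    (hbs : PowerSandwich α q fun i => (b i)⁻¹) (hrs : PowerSandwich α q fun i => (r i)⁻¹) :
    ∃ C : ℝ, 0 ≤ C ∧ ∃ k₁ : ℕ, 1 ≤ k₁ ∧ ∀ k, k₁ ≤ k → ∀ j,
      (k ≤ j → r j / b k ≤ 1 + C / k) ∧ (j ≤ k → 1 - C / k ≤ r j / b k) := by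
  obtain ⟨N, hN⟩ := exists_nat_ge (4 * q * α)
  refine ⟨8 * q * α, by positivity, N + 2 * q + 1, by omega, fun k hk j => ?_⟩
  have hk0 : (0:ℝ) < k := by exact_mod_cast (by omega : 0 < k)
  have hkN : 4 * q * α ≤ k := hN.trans (by exact_mod_cast (by omega : N ≤ k))
  have hkq : 2 * (q:ℝ) + 1 ≤ k := by exact_mod_cast (by omega : 2 * q + 1 ≤ k)
  have hsub : ((k - q : ℕ) : ℝ) = k - q := Nat.cast_sub (by omega)
  have hlow : (0:ℝ) < 2 * ((k - q : ℕ) : ℝ) := by rw [hsub]; linarith [(Nat.cast_nonneg q : (0:ℝ) ≤ q)]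
  set L : ℝ := (2 * ((k - q : ℕ) : ℝ)) ^ α with hL
  set H : ℝ := (2 * ((k + q : ℕ) : ℝ)) ^ α with hH
  have hL0 : 0 < L := Real.rpow_pos_of_pos hlow _
  have hC0 : 0 ≤ 8 * q * α / k := by positivity
  have hHL : H ≤ (1 + 8 * q * α / k) * L := by
    have h1 : 2 * ((k + q : ℕ) : ℝ) ≤ Real.exp (4 * q / k) * (2 * ((k - q : ℕ) : ℝ)) := by
      have h2 : 1 + 4 * (q:ℝ) / k ≤ Real.exp (4 * q / k) := by
        linarith [Real.add_one_le_exp (4 * (q:ℝ) / k)]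
      refine le_trans ?_ (mul_le_mul_of_nonneg_right h2 hlow.le)
      rw [hsub]; push_cast
      have h3 : 4 * (q:ℝ) / k * (2 * (k - q)) = 8 * q - 8 * q * q / k := by field_simp; ring
      have h4 : 8 * (q:ℝ) * q / k ≤ 4 * q := by
        rw [div_le_iff₀ hk0]; nlinarith [(Nat.cast_nonneg q : (0:ℝ) ≤ q)]
      nlinarith
    calc H ≤ (Real.exp (4 * q / k) * (2 * ((k - q : ℕ) : ℝ))) ^ α :=
          Real.rpow_le_rpow (by positivity) h1 hα.le
      _ = Real.exp (4 * q / k * α) * L := by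
          rw [Real.mul_rpow (by positivity) hlow.le, ← Real.exp_mul]
      _ ≤ _ := by
          refine mul_le_mul_of_nonneg_right ?_ hL0.le
          have hx1 : 4 * (q:ℝ) / k * α ≤ 1 := by
            rw [div_mul_eq_mul_div, div_le_one hk0]; exact hkN
          have hx0 : 0 ≤ 4 * (q:ℝ) / k * α := by positivity
          have h := Real.abs_exp_sub_one_le (x := 4 * (q:ℝ) / k * α)
            (by rwa [abs_of_nonneg hx0])
          rw [abs_of_nonneg hx0] at h
          have := le_abs_self (Real.exp (4 * (q:ℝ) / k * α) - 1)
          have e : 8 * (q:ℝ) * α / k = 2 * (4 * q / k * α) := by ring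
          rw [e]; linarith
  have hratio : r j / b k = (b k)⁻¹ / (r j)⁻¹ := by
    have := (hb k).ne'; have := (hr j).ne'; field_simp
  rw [hratio]
  have hrj := inv_pos.2 (hr j)
  constructor
  · intro hj
    rw [div_le_iff₀ hrj]
    have h1 : L ≤ (r j)⁻¹ := le_trans (Real.rpow_le_rpow hlow.le
      (by gcongr) hα.le) (hrs j).1
    calc (b k)⁻¹ ≤ H := (hbs k).2
      _ ≤ (1 + 8 * q * α / k) * L := hHL
      _ ≤ _ := by gcongr
  · intro hj
    rw [le_div_iff₀ hrj]
    have h1 : (r j)⁻¹ ≤ H := (hrs j).2.trans (Real.rpow_le_rpow (by positivity)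
      (by gcongr) hα.le)
    have h2 := (hbs k).1
    rcases le_or_gt 0 (1 - 8 * q * α / k) with hc | hc
    · calc (1 - 8 * q * α / k) * (r j)⁻¹ ≤
            (1 - 8 * q * α / k) * ((1 + 8 * q * α / k) * L) := by gcongr; exact h1.trans hHL
        _ = (1 - (8 * q * α / k) ^ 2) * L := by ring
        _ ≤ 1 * L := by gcongr; linarith [sq_nonneg (8 * q * α / k)]
        _ ≤ _ := by rw [one_mul]; exact h2
    · exact (mul_nonpos_of_nonpos_of_nonneg hc.le hrj.le).trans (inv_pos.2 (hb k)).le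

end PowerSandwich

namespace BalancedChain

variable {Ω : Type*} [MeasurableSpace Ω] {μ : Measure Ω} [IsProbabilityMeasure μ]
  {b r : ℕ → ℝ} {X : ℕ → Ω → ℕ}

lemma integrable_comp (h : BalancedChain μ b r X) (hb : ∀ i, 0 < b i) (hr : ∀ i, 0 < r i)
    (hr0 : Tendsto r atTop (nhds 0)) {f : ℕ → ℝ} (hf : ExpBounded f) (k : ℕ) :
    Integrable (fun ω => f (X k ω)) μ := by
  obtain ⟨C, θ, hC, hθ, hf⟩ := hf
  refine ((h.integrable_exp hb hr hr0 hθ k).const_mul C).mono'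
    ((measurable_of_countable f).comp (h.meas k)).aestronglyMeasurable
    (Eventually.of_forall fun ω => hf _)

lemma memLp_comp (h : BalancedChain μ b r X) (hb : ∀ i, 0 < b i) (hr : ∀ i, 0 < r i)
    (hr0 : Tendsto r atTop (nhds 0)) {f : ℕ → ℝ} (hf : ExpBounded f) (k : ℕ) :
    MemLp (fun ω => f (X k ω)) 2 μ :=
  (memLp_two_iff_integrable_sq
    ((measurable_of_countable f).comp (h.meas k)).aestronglyMeasurable).2
    (by simpa only [pow_two, Function.comp_apply] using h.integrable_comp hb hr hr0 (hf.mul hf) k)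

lemma integrable_mul_comp (h : BalancedChain μ b r X) (hb : ∀ i, 0 < b i) (hr : ∀ i, 0 < r i)
    (hr0 : Tendsto r atTop (nhds 0)) {f g : ℕ → ℝ} (hf : ExpBounded f) (hg : ExpBounded g)
    (n k : ℕ) : Integrable (fun ω => f (X n ω) * g (X k ω)) μ :=
  (h.memLp_comp hb hr hr0 hf n).integrable_mul (h.memLp_comp hb hr hr0 hg k)

lemma expBounded_rate (hr : ∀ i, 0 < r i) (hr0 : Tendsto r atTop (nhds 0)) : ExpBounded r := by
  obtain ⟨R, hR⟩ := hr0.bddAbove_range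
  refine (ExpBounded.const R).of_le fun j => ?_
  rw [abs_of_pos (hr j)]
  exact (hR ⟨j, rfl⟩).trans (le_abs_self R)

/-- Contraction of the hyperbolic cosine moments of `X k - k`. -/
lemma integral_cosh_succ_le (h : BalancedChain μ b r X) (hb : ∀ i, 0 < b i) (hr : ∀ i, 0 < r i)
    (hr0 : Tendsto r atTop (nhds 0)) {θ c : ℝ} (hθ : 0 < θ) (hθ1 : θ ≤ 1) (hc : 0 ≤ c) {k : ℕ}
    (hratio : ∀ j, (k ≤ j → r j / b k ≤ 1 + c) ∧ (j ≤ k → 1 - c ≤ r j / b k)) :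
    (1 - 6 * θ ^ 2 - 18 * c * θ) * ∫ ω, Real.cosh (θ * (X (k + 1) ω - (k + 1 : ℕ))) ∂μ ≤
      ∫ ω, Real.cosh (θ * (X k ω - k)) ∂μ := by
  set F : ℕ → ℝ := fun j => Real.cosh (θ * ((j : ℝ) - k)) with hF
  have hFb : ExpBounded F := ExpBounded.cosh_mul_sub hθ k
  have hrb : ExpBounded r := expBounded_rate hr hr0
  have hi := h.integrable_comp hb hr hr0 ((hFb.succ.sub hFb).mul hrb) (k + 1)
  have hid := h.integral_mul_sub hb hr (Nat.zero_le k) (fun _ => 1) F (by simpa only [one_mul] using hi)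
  simp only [one_mul] at hid
  rw [integral_sub (h.integrable_comp hb hr hr0 hFb _) (h.integrable_comp hb hr hr0 hFb _)] at hid
  have hbk := hb k
  have hpt : ∀ j : ℕ, (1 - 6 * θ ^ 2 - 18 * c * θ) * Real.cosh (θ * ((j : ℝ) - (k + 1 : ℕ))) ≤
      F j - (b k)⁻¹ * ((F (j + 1) - F j) * r j) := by
    intro j
    have := cosh_step (u := r j / b k) (y := (j : ℝ) - k) hθ hθ1 hc (by
      rcases le_or_gt k j with hj | hj
      · exact Or.inl ⟨by rw [sub_nonneg]; exact_mod_cast hj, (hratio j).1 hj⟩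
      · refine Or.inr ⟨?_, (hratio j).2 hj.le⟩
        have : (j : ℝ) + 1 ≤ k := by exact_mod_cast hj
        linarith)
    calc _ = Real.cosh (θ * ((j : ℝ) - k - 1)) * (1 - 6 * θ ^ 2 - 18 * c * θ) := by
          rw [mul_comm]; push_cast; ring_nf
      _ ≤ _ := this
      _ = _ := by
          simp only [hF]; push_cast
          rw [show (j : ℝ) + 1 - k = j - k + 1 by ring]; field_simp
  have hmono := integral_mono
    ((h.integrable_comp hb hr hr0 (ExpBounded.cosh_mul_sub hθ ((k + 1 : ℕ) : ℝ)) (k + 1)).const_mul _)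
    ((h.integrable_comp hb hr hr0 hFb (k + 1)).sub (hi.const_mul (b k)⁻¹)) fun ω => hpt (X (k + 1) ω)
  simp only [Pi.sub_apply] at hmono
  rw [integral_const_mul, integral_sub (h.integrable_comp hb hr hr0 hFb _) (hi.const_mul _),
    integral_const_mul, ← hid, inv_mul_cancel_left₀ hbk.ne'] at hmono
  simpa [hF] using hmono

/-- On the time window `[n, 2 n]` the variables `(X k - k) / √n` have bounded exponential
moments. -/
lemma exists_exp_moment_bound (h : BalancedChain μ b r X) {α : ℝ} {q : ℕ} (hα : 0 < α)
    (hb : ∀ i, 0 < b i) (hr : ∀ i, 0 < r i)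
    (hbs : PowerSandwich α q fun i => (b i)⁻¹) (hrs : PowerSandwich α q fun i => (r i)⁻¹) :
    ∃ C : ℝ, ∃ N : ℕ, ∀ n, N ≤ n → ∀ k, n ≤ k → k ≤ 2 * n →
      ∫ ω, Real.exp ((Real.sqrt n)⁻¹ * |(X k ω : ℝ) - k|) ∂μ ≤ C := by
  have hr0 := hrs.tendsto_rate hα
  obtain ⟨C₀, hC₀, k₁, hk₁, hratio⟩ := PowerSandwich.exists_ratio_bound hα hb hr hbs hrs
  set C₁ : ℝ := ∫ ω, Real.exp (1 * |(X k₁ ω : ℝ) - k₁|) ∂μ with hC₁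
  obtain ⟨M, hM⟩ := exists_nat_ge (12 + 36 * C₀)
  refine ⟨2 * (C₁ * Real.exp (24 + 2 * (108 * C₀))), k₁ + M ^ 2 + 1, fun n hn k hk hk2 => ?_⟩
  have hn1 : (1:ℝ) ≤ n := by exact_mod_cast (by omega : 1 ≤ n)
  set s := Real.sqrt n with hs
  have hs1 : 1 ≤ s := Real.one_le_sqrt.2 hn1
  have hss : s * s = n := Real.mul_self_sqrt (by linarith)
  have hsM : 12 + 36 * C₀ ≤ s := hM.trans (Real.le_sqrt_of_sq_le (by
    exact_mod_cast (by omega : M ^ 2 ≤ n)))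
  set θ := s⁻¹ with hθdef
  have hθ : 0 < θ := by positivity
  have hθ1 : θ ≤ 1 := inv_le_one_of_one_le₀ hs1
  have hθs : θ * s = 1 := inv_mul_cancel₀ (by positivity)
  have hθM : θ * (12 + 36 * C₀) ≤ 1 := by rw [← hθs]; gcongr
  set Q : ℕ → ℝ := fun k => ∫ ω, Real.cosh (θ * (X k ω - k)) ∂μ with hQ
  have hQ0 : ∀ k, 0 ≤ Q k := fun k => integral_nonneg fun ω => (Real.cosh_pos _).le
  have hstep : ∀ k, k₁ ≤ k → Q (k + 1) ≤ Real.exp (2 * (6 * θ ^ 2 + 18 * (C₀ / k) * θ)) * Q k := by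
    intro k hk
    have hk0 : (1:ℝ) ≤ k := by exact_mod_cast hk₁.trans hk
    have h1 := h.integral_cosh_succ_le hb hr hr0 hθ hθ1 (by positivity : 0 ≤ C₀ / k)
      (hratio k hk)
    set x := 6 * θ ^ 2 + 18 * (C₀ / k) * θ with hx
    have hx0 : 0 ≤ x := by positivity
    have hCk : C₀ / k ≤ C₀ := div_le_self hC₀ hk0
    have hx1 : x ≤ 1 / 2 := by nlinarith
    have h2 : 1 ≤ (1 - x) * Real.exp (2 * x) := by
      nlinarith [Real.add_one_le_exp (2 * x)]
    have h1' : (1 - x) * Q (k + 1) ≤ Q k := by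
      simp only [hQ]; refine le_trans (le_of_eq ?_) h1; rw [hx]; ring
    calc Q (k + 1) ≤ ((1 - x) * Real.exp (2 * x)) * Q (k + 1) :=
          le_mul_of_one_le_left (hQ0 _) h2
      _ = Real.exp (2 * x) * ((1 - x) * Q (k + 1)) := by ring
      _ ≤ _ := by gcongr
  have hiter : ∀ k, k₁ ≤ k →
      Q k ≤ Q k₁ * Real.exp (12 * θ ^ 2 * k + 108 * C₀ * θ * Real.sqrt k) := by
    intro k hk
    induction k, hk using Nat.le_induction with
    | base => exact le_mul_of_one_le_right (hQ0 _) (Real.one_le_exp (by positivity))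
    | succ k hk ih =>
      have hk0 : (1:ℝ) ≤ k := by exact_mod_cast hk₁.trans hk
      have hsq : (1:ℝ) / k ≤ 3 * (Real.sqrt (k + 1) - Real.sqrt k) := by
        have e1 : Real.sqrt (k + 1) * Real.sqrt (k + 1) = k + 1 := Real.mul_self_sqrt (by linarith)
        have e2 : Real.sqrt k * Real.sqrt k = k := Real.mul_self_sqrt (by linarith)
        have e3 : Real.sqrt k ≤ k := by
          rw [Real.sqrt_le_left (by linarith)]; nlinarith
        have e4 : Real.sqrt (k + 1) ≤ k + 1 := by
          rw [Real.sqrt_le_left (by linarith)]; nlinarith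
        have e5 : Real.sqrt k ≤ Real.sqrt (k + 1) := Real.sqrt_le_sqrt (by linarith)
        rw [div_le_iff₀ (by linarith)]
        have e6 : (Real.sqrt (k + 1) - Real.sqrt k) * (Real.sqrt (k + 1) + Real.sqrt k) = 1 := by
          linear_combination e1 - e2
        nlinarith [mul_le_mul_of_nonneg_left (by linarith : Real.sqrt (k + 1) + Real.sqrt k ≤ 3 * k)
          (sub_nonneg.2 e5)]
      refine (hstep k hk).trans ?_
      calc _ ≤ Real.exp (2 * (6 * θ ^ 2 + 18 * (C₀ / k) * θ)) *
            (Q k₁ * Real.exp (12 * θ ^ 2 * k + 108 * C₀ * θ * Real.sqrt k)) := by gcongr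
        _ = Q k₁ * Real.exp (2 * (6 * θ ^ 2 + 18 * (C₀ / k) * θ) +
            (12 * θ ^ 2 * k + 108 * C₀ * θ * Real.sqrt k)) := by
          rw [Real.exp_add (2 * (6 * θ ^ 2 + 18 * (C₀ / k) * θ))]; ring
        _ ≤ _ := by
          refine mul_le_mul_of_nonneg_left (Real.exp_le_exp.2 ?_) (hQ0 _)
          push_cast
          have : 36 * C₀ * θ * (1 / k) ≤ 36 * C₀ * θ * (3 * (Real.sqrt (k + 1) - Real.sqrt k)) := by
            gcongr
          have e : C₀ / k = C₀ * (1 / k) := by ring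
          rw [e]; linarith
  have hfin : 12 * θ ^ 2 * k + 108 * C₀ * θ * Real.sqrt k ≤ 24 + 2 * (108 * C₀) := by
    have hk2' : (k:ℝ) ≤ 2 * n := by exact_mod_cast hk2
    have e1 : θ ^ 2 * k ≤ 2 := by
      calc θ ^ 2 * k ≤ θ ^ 2 * (2 * (s * s)) := by rw [hss]; gcongr
        _ = 2 * (θ * s) ^ 2 := by ring
        _ = 2 := by rw [hθs]; norm_num
    have e2 : Real.sqrt k ≤ 2 * s := by
      rw [Real.sqrt_le_left (by positivity)]; nlinarith
    have e3 : θ * Real.sqrt k ≤ 2 := by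
      calc θ * Real.sqrt k ≤ θ * (2 * s) := by gcongr
        _ = 2 := by linarith
    have : 108 * C₀ * (θ * Real.sqrt k) ≤ 108 * C₀ * 2 := by gcongr
    linarith
  have hQk₁ : Q k₁ ≤ C₁ := by
    refine integral_mono (h.integrable_comp hb hr hr0 (ExpBounded.cosh_mul_sub hθ k₁) k₁)
      (h.integrable_comp hb hr hr0 (ExpBounded.exp_abs_sub one_pos k₁) k₁) fun ω => ?_
    refine (cosh_le_exp_abs _).trans (Real.exp_le_exp.2 ?_)
    rw [abs_mul, abs_of_pos hθ]; gcongr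
  calc _ ≤ ∫ ω, 2 * Real.cosh (θ * (X k ω - k)) ∂μ := by
        refine integral_mono (h.integrable_comp hb hr hr0 (ExpBounded.exp_abs_sub hθ k) k)
          ((h.integrable_comp hb hr hr0 (ExpBounded.cosh_mul_sub hθ k) k).const_mul 2) fun ω => ?_
        have e : θ * |(X k ω : ℝ) - k| = |θ * ((X k ω : ℝ) - k)| := by
          rw [abs_mul, abs_of_pos hθ]
        simp only [e]
        rw [← Real.cosh_abs, Real.cosh_eq]
        linarith [Real.exp_pos (-|θ * ((X k ω : ℝ) - k)|)]
    _ = 2 * Q k := integral_const_mul _ _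
    _ ≤ 2 * (C₁ * Real.exp (24 + 2 * (108 * C₀))) := by
        have hC₁0 : 0 ≤ C₁ := (hQ0 _).trans hQk₁
        refine mul_le_mul_of_nonneg_left ((hiter k (by omega)).trans ?_) two_pos.le
        exact mul_le_mul hQk₁ (Real.exp_le_exp.2 hfin) (Real.exp_pos _).le hC₁0

end BalancedChain

/-- Quantitative continuity of a power function at `1`, with exponential growth at infinity. -/
lemma exists_abs_rpow_sub_one_le {α : ℝ} (hα : 0 < α) :
    ∃ C : ℝ, 0 ≤ C ∧ ∀ t : ℝ, 0 ≤ t → |t ^ α - 1| ≤ C * |t - 1| * Real.exp (C * |t - 1|) := by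
  refine ⟨2 * α + 2, by positivity, fun t ht => ?_⟩
  have hexp : 1 ≤ Real.exp ((2 * α + 2) * |t - 1|) := Real.one_le_exp (by positivity)
  rcases le_or_gt 1 t with h1 | h1
  · have hx : 0 ≤ t - 1 := by linarith
    rw [abs_of_nonneg hx, abs_of_nonneg (by linarith [Real.one_le_rpow h1 hα.le])]
    have h2 : t ^ α ≤ Real.exp ((t - 1) * α) := by
      rw [Real.exp_mul]
      exact Real.rpow_le_rpow ht (by linarith [Real.add_one_le_exp (t - 1)]) hα.le
    set y := (t - 1) * α with hy
    have hy0 : 0 ≤ y := by positivity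
    have h3 : Real.exp y - 1 ≤ y * Real.exp y := by
      have h4 := mul_le_mul_of_nonneg_right (Real.add_one_le_exp (-y)) (Real.exp_pos y).le
      rw [← Real.exp_add, neg_add_cancel, Real.exp_zero] at h4
      linarith
    have h5 : y ≤ (2 * α + 2) * (t - 1) := by nlinarith
    calc t ^ α - 1 ≤ y * Real.exp y := by linarith
      _ ≤ _ := by gcongr
  · rw [abs_of_nonpos (by linarith : t - 1 ≤ 0)] at hexp ⊢
    have hle : t ^ α ≤ 1 := Real.rpow_le_one ht h1.le hα.le
    have hnn : 0 ≤ t ^ α := Real.rpow_nonneg ht _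
    rw [abs_of_nonpos (by linarith)]
    have key : 1 - t ^ α ≤ (2 * α + 2) * (1 - t) := by
      rcases le_or_gt (1 / 2) t with h2 | h2
      · have h3 : Real.exp (-(2 * (1 - t))) ≤ t := by
          rw [← Real.le_log_iff_exp_le (by linarith)]
          have h4 := Real.one_sub_inv_le_log_of_pos (by linarith : 0 < t)
          refine le_trans ?_ h4
          have h5 : t * t⁻¹ = 1 := mul_inv_cancel₀ (by linarith)
          have h6 : t⁻¹ ≤ 2 := by rw [inv_le_comm₀ (by linarith) two_pos]; linarith
          nlinarith
        have h7 : Real.exp (-(2 * (1 - t)) * α) ≤ t ^ α := by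
          rw [Real.exp_mul]; exact Real.rpow_le_rpow (Real.exp_pos _).le h3 hα.le
        nlinarith [Real.add_one_le_exp (-(2 * (1 - t)) * α)]
      · nlinarith
    have h8 : 0 ≤ (2 * α + 2) * (1 - t) := by nlinarith
    rw [neg_sub, neg_sub] at *
    exact key.trans (le_mul_of_one_le_right h8 hexp)

/-- A sum over an interval of a sequence which is close to the constant `s`. -/
lemma abs_sum_range_sub_sum_range_le {a : ℕ → ℝ} {s M : ℝ} {j k : ℕ}
    (h : ∀ i : ℕ, |(i : ℝ) - k| ≤ |(j : ℝ) - k| → |a i - s| ≤ M) :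
    |∑ i ∈ Finset.range j, a i - ∑ i ∈ Finset.range k, a i - s * ((j : ℝ) - k)| ≤
      M * |(j : ℝ) - k| := by
  have aux : ∀ {x y : ℕ}, x ≤ y → (∀ i, x ≤ i → i < y → |a i - s| ≤ M) →
      |∑ i ∈ Finset.range y, a i - ∑ i ∈ Finset.range x, a i - s * ((y : ℝ) - x)| ≤
        M * |(y : ℝ) - x| := by
    intro x y hxy hi
    have hc : ((y - x : ℕ) : ℝ) = y - x := Nat.cast_sub hxy
    rw [← Finset.sum_Ico_eq_sub _ hxy]
    have e : ∑ i ∈ Finset.Ico x y, a i - s * ((y : ℝ) - x) = ∑ i ∈ Finset.Ico x y, (a i - s) := by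
      rw [Finset.sum_sub_distrib, Finset.sum_const, Nat.card_Ico, nsmul_eq_mul, hc]; ring
    rw [e, ← hc, Nat.abs_cast]
    refine (Finset.abs_sum_le_sum_abs _ _).trans ((Finset.sum_le_card_nsmul _ _ M fun i hm => ?_).trans_eq ?_)
    · rw [Finset.mem_Ico] at hm; exact hi i hm.1 hm.2
    · rw [Nat.card_Ico, nsmul_eq_mul]; ring
  rcases le_total k j with hkj | hjk
  · refine aux hkj fun i h1 h2 => h i ?_
    have h1' : (k : ℝ) ≤ i := by exact_mod_cast h1
    have h2' : (i : ℝ) ≤ j := by exact_mod_cast h2.le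
    rw [abs_of_nonneg (by linarith), abs_of_nonneg (by linarith)]; linarith
  · have := aux hjk fun i h1 h2 => h i (by
      have h1' : (j : ℝ) ≤ i := by exact_mod_cast h1
      have h2' : (i : ℝ) ≤ k := by exact_mod_cast h2.le
      rw [abs_of_nonpos (by linarith), abs_of_nonpos (by linarith)]; linarith)
    rw [abs_sub_comm (k : ℝ), ← abs_neg] at this
    refine le_trans (le_of_eq ?_) this
    congr 1; ring

namespace PowerSandwich

variable {α : ℝ} {q : ℕ} {a a' : ℕ → ℝ}

lemma exists_abs_sub_le (hα : 0 < α) (h : PowerSandwich α q a) :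
    ∃ C : ℝ, 0 ≤ C ∧ ∀ k j : ℕ, 1 ≤ k → |a j - (2 * (k : ℝ)) ^ α| ≤
      (2 * (k : ℝ)) ^ α * (C * ((|(j : ℝ) - k| + 1) / k) *
        Real.exp (C * ((|(j : ℝ) - k| + 1) / k))) := by
  obtain ⟨C, hC, hpow⟩ := exists_abs_rpow_sub_one_le hα
  refine ⟨C * (q + 1), by positivity, fun k j hk => ?_⟩
  have hk0 : (0:ℝ) < k := by exact_mod_cast hk
  set s := (2 * (k : ℝ)) ^ α with hs
  have hs0 : 0 ≤ s := by positivity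
  set x := (|(j : ℝ) - k| + 1) / k with hx
  have hq0 : (0:ℝ) ≤ q := Nat.cast_nonneg q
  have aux : ∀ i : ℕ, |(i : ℝ) - j| ≤ q →
      |(2 * (i : ℝ)) ^ α - s| ≤ s * (C * (q + 1) * x * Real.exp (C * (q + 1) * x)) := by
    intro i hi
    have e : (2 * (i : ℝ)) ^ α = s * ((i : ℝ) / k) ^ α := by
      rw [hs, ← Real.mul_rpow (by positivity) (by positivity)]; congr 1; field_simp
    have e2 : s * ((i : ℝ) / k) ^ α - s = s * (((i : ℝ) / k) ^ α - 1) := by ring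
    rw [e, e2, abs_mul, abs_of_nonneg hs0]
    have h1 : |(i : ℝ) / k - 1| ≤ (q + 1) * x := by
      have e3 : (i : ℝ) / k - 1 = ((i : ℝ) - k) / k := by field_simp
      rw [e3, abs_div, abs_of_pos hk0, hx, mul_div_assoc']
      gcongr
      have := abs_sub_le (i : ℝ) j k
      nlinarith [abs_nonneg ((j : ℝ) - k)]
    refine mul_le_mul_of_nonneg_left ((hpow _ (by positivity)).trans ?_) hs0
    calc _ ≤ C * ((q + 1) * x) * Real.exp (C * ((q + 1) * x)) := by gcongr
      _ = _ := by ring_nf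
  have hup := aux (j + q) (by push_cast; rw [add_sub_cancel_left, abs_of_nonneg hq0])
  have hlo := aux (j - q) (by
    rw [abs_le]
    have h1 : (j : ℝ) ≤ ((j - q : ℕ) : ℝ) + q := by exact_mod_cast (by omega)
    have h2 : ((j - q : ℕ) : ℝ) ≤ j := by exact_mod_cast (by omega)
    constructor <;> linarith)
  have hj := h j
  rw [abs_le] at hup hlo ⊢
  constructor <;> linarith

lemma exists_abs_sum_sub_sum_le (hα : 0 < α) (h : PowerSandwich α q a)
    (h' : PowerSandwich α q a') :
    ∃ C : ℝ, 0 ≤ C ∧ ∀ k : ℕ, 1 ≤ k →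
      |∑ i ∈ Finset.range k, a i - ∑ i ∈ Finset.range k, a' i| ≤ C * (2 * (k : ℝ)) ^ α := by
  refine ⟨2 * q * (q + 1 : ℝ) ^ α, by positivity, fun k hk => ?_⟩
  set P : ℕ → ℝ := fun i => (2 * (i : ℝ)) ^ α with hP
  have hP0 : ∀ i, 0 ≤ P i := fun i => by positivity
  have hPm : Monotone P := fun i j hij => by simp only [hP]; gcongr
  have hend : P (k + q) ≤ (q + 1 : ℝ) ^ α * (2 * (k : ℝ)) ^ α := by
    rw [← Real.mul_rpow (by positivity) (by positivity)]
    refine Real.rpow_le_rpow (by positivity) ?_ hα.le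
    have : (1:ℝ) ≤ k := by exact_mod_cast hk
    push_cast
    nlinarith [(Nat.cast_nonneg q : (0:ℝ) ≤ q)]
  have hcmp : ∑ i ∈ Finset.range k, P (i + q) ≤
      ∑ i ∈ Finset.range k, P (i - q) + 2 * q * P (k + q) := by
    have h1 : ∑ i ∈ Finset.range k, P (i + q) ≤ ∑ i ∈ Finset.range (k + q), P i := by
      rw [add_comm k q, Finset.sum_range_add]
      simp only [add_comm q]
      exact le_add_of_nonneg_left (Finset.sum_nonneg fun i _ => hP0 i)
    have h2 : ∑ i ∈ Finset.range (k + q), P i ≤ ∑ i ∈ Finset.range (q + (k + q)), P (i - q) := by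
      rw [Finset.sum_range_add (fun i => P (i - q)) q]
      simp only [Nat.add_sub_cancel_left]
      exact le_add_of_nonneg_left (Finset.sum_nonneg fun i _ => hP0 _)
    have h3 : ∑ i ∈ Finset.range (q + (k + q)), P (i - q) ≤
        ∑ i ∈ Finset.range k, P (i - q) + 2 * q * P (k + q) := by
      rw [show q + (k + q) = k + 2 * q by ring, Finset.sum_range_add]
      gcongr
      refine (Finset.sum_le_card_nsmul _ _ (P (k + q)) fun i hi => hPm ?_).trans_eq ?_
      · rw [Finset.mem_range] at hi; omega
      · rw [Finset.card_range, nsmul_eq_mul]; push_cast; ring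
    exact h1.trans (h2.trans h3)
  have hb : ∀ {c : ℕ → ℝ}, PowerSandwich α q c →
      ∑ i ∈ Finset.range k, P (i - q) ≤ ∑ i ∈ Finset.range k, c i ∧
      ∑ i ∈ Finset.range k, c i ≤ ∑ i ∈ Finset.range k, P (i + q) := fun hc =>
    ⟨Finset.sum_le_sum fun i _ => (hc i).1, Finset.sum_le_sum fun i _ => (hc i).2⟩
  have h1 := hb h
  have h2 := hb h'
  have h3 : 2 * (q:ℝ) * P (k + q) ≤ 2 * q * ((q + 1 : ℝ) ^ α * (2 * (k : ℝ)) ^ α) := by gcongr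
  rw [abs_le]
  constructor <;> linarith

/-- In a window of size `√n` around `k ≥ n` the sequence is constant up to a relative error of
order `1 / √n`. -/
lemma exists_abs_sub_le_exp (hα : 0 < α) (h : PowerSandwich α q a) :
    ∃ C : ℝ, 0 ≤ C ∧ ∃ N : ℕ, 1 ≤ N ∧ ∀ n, N ≤ n → ∀ k, n ≤ k → ∀ j : ℕ,
      |a j - (2 * (k : ℝ)) ^ α| ≤ C * (2 * (k : ℝ)) ^ α * (Real.sqrt n)⁻¹ *
        Real.exp ((Real.sqrt n)⁻¹ * |(j : ℝ) - k| / 4) := by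
  obtain ⟨C, hC, hle⟩ := h.exists_abs_sub_le hα
  obtain ⟨M, hM⟩ := exists_nat_ge (8 * C + 1)
  refine ⟨8 * C * Real.exp 1, by positivity, M ^ 2 + 1, by omega, fun n hn k hk j => ?_⟩
  have hn1 : (1:ℝ) ≤ n := by exact_mod_cast (by omega : 1 ≤ n)
  have hnk : (n:ℝ) ≤ k := by exact_mod_cast hk
  set σ := Real.sqrt n with hσ
  have hσM : 8 * C + 1 ≤ σ := hM.trans (Real.le_sqrt_of_sq_le (by
    exact_mod_cast (by omega : M ^ 2 ≤ n)))
  have hσσ : σ * σ = n := Real.mul_self_sqrt (by linarith)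
  have hσ0 : 0 < σ := by linarith
  set θ := σ⁻¹ with hθ
  have hθ0 : 0 < θ := by positivity
  have hθσ : θ * σ = 1 := inv_mul_cancel₀ hσ0.ne'
  set d := |(j : ℝ) - k| with hd
  have hd0 : 0 ≤ d := abs_nonneg _
  set x := (d + 1) / k with hx
  have hx1 : x ≤ θ * (θ * (d + 1)) := by
    have : θ * (θ * (d + 1)) = (d + 1) / n := by rw [← hσσ, hθ]; field_simp
    rw [this, hx]; gcongr
  have hθ1 : θ ≤ 1 := inv_le_one_of_one_le₀ (by linarith)
  have hCθ : 8 * C * θ ≤ 1 := by nlinarith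
  have hx2 : x ≤ θ * (8 * Real.exp (θ * d / 8)) := by
    refine hx1.trans (mul_le_mul_of_nonneg_left ?_ hθ0.le)
    linarith [Real.add_one_le_exp (θ * d / 8)]
  have hx3 : C * x ≤ θ * d / 8 + 1 := by
    have h1 : C * x ≤ C * (θ * (θ * (d + 1))) := by gcongr
    have h2 : 8 * C * θ * (θ * (d + 1)) ≤ 1 * (θ * (d + 1)) := by gcongr
    linarith
  refine (hle k j (by omega)).trans ?_
  calc _ ≤ (2 * (k : ℝ)) ^ α * (C * (θ * (8 * Real.exp (θ * d / 8))) *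
        Real.exp (θ * d / 8 + 1)) := by gcongr
    _ = 8 * C * Real.exp 1 * (2 * (k : ℝ)) ^ α * θ *
        (Real.exp (θ * d / 8) * Real.exp (θ * d / 8)) := by rw [Real.exp_add]; ring
    _ = _ := by rw [← Real.exp_add]; ring_nf

/-- In a window of size `√n` around `k ≥ n` the partial sums of two comparable sequences are
affine up to an error of the order of one summand. -/
lemma exists_sum_sub_sum_le_exp (hα : 0 < α) (h : PowerSandwich α q a)
    (h' : PowerSandwich α q a') :
    ∃ C : ℝ, 0 ≤ C ∧ ∃ N : ℕ, ∀ n, N ≤ n → ∀ k, n ≤ k → ∀ j : ℕ,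
      |∑ i ∈ Finset.range j, a i - ∑ i ∈ Finset.range k, a' i -
          (2 * (k : ℝ)) ^ α * ((j : ℝ) - k)| ≤
        C * (2 * (k : ℝ)) ^ α * Real.exp ((Real.sqrt n)⁻¹ * |(j : ℝ) - k| / 2) := by
  obtain ⟨C, hC, N, hN, hle⟩ := h.exists_abs_sub_le_exp hα
  obtain ⟨C', hC', hle'⟩ := h.exists_abs_sum_sub_sum_le hα h'
  refine ⟨4 * C + C', by positivity, N, fun n hn k hk j => ?_⟩
  set θ := (Real.sqrt n)⁻¹ with hθ
  have hθ0 : 0 ≤ θ := by positivity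
  set s := (2 * (k : ℝ)) ^ α with hs
  have hs0 : 0 ≤ s := by positivity
  set d := |(j : ℝ) - k| with hd
  have hd0 : 0 ≤ d := abs_nonneg _
  have h1 := abs_sum_range_sub_sum_range_le (a := a) (s := s)
    (M := C * s * θ * Real.exp (θ * d / 4)) (j := j) (k := k) fun i hi =>
      (hle n hn k hk i).trans (by gcongr)
  have h2 := hle' k (by omega)
  have h3 : θ * d ≤ 4 * Real.exp (θ * d / 4) := by linarith [Real.add_one_le_exp (θ * d / 4)]
  have h4 : C * s * θ * Real.exp (θ * d / 4) * d ≤ 4 * C * s * Real.exp (θ * d / 2) := by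
    calc _ = C * s * Real.exp (θ * d / 4) * (θ * d) := by ring
      _ ≤ C * s * Real.exp (θ * d / 4) * (4 * Real.exp (θ * d / 4)) := by gcongr
      _ = 4 * C * s * (Real.exp (θ * d / 4) * Real.exp (θ * d / 4)) := by ring
      _ = _ := by rw [← Real.exp_add]; ring_nf
  have h5 : C' * s ≤ C' * s * Real.exp (θ * d / 2) :=
    le_mul_of_one_le_right (by positivity) (Real.one_le_exp (by positivity))
  rw [abs_le] at h1 h2 ⊢
  constructor <;> linarith

end PowerSandwich

lemma PowerSandwich.expBounded {α : ℝ} {q : ℕ} {a : ℕ → ℝ} (hα : 0 < α)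
    (h : PowerSandwich α q a) : ExpBounded a := by
  refine ⟨Real.exp (2 * q * α), 2 * α, by positivity, by positivity, fun j => ?_⟩
  have h0 : 0 ≤ a j := le_trans (by positivity) (h j).1
  rw [abs_of_nonneg h0, ← Real.exp_add]
  refine (h j).2.trans ?_
  calc (2 * ((j + q : ℕ) : ℝ)) ^ α ≤ Real.exp (2 * ((j + q : ℕ) : ℝ)) ^ α := by
        refine Real.rpow_le_rpow (by positivity) ?_ hα.le
        linarith [Real.add_one_le_exp (2 * ((j + q : ℕ) : ℝ))]
    _ = _ := by rw [← Real.exp_mul]; push_cast; ring_nf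

lemma ExpBounded.sum_range {f : ℕ → ℝ} (hf : ExpBounded f) :
    ExpBounded fun j => ∑ i ∈ Finset.range j, f i := by
  obtain ⟨C, θ, hC, hθ, hf⟩ := hf
  refine (ExpBounded.natCast.mul ⟨C, θ, hC, hθ, fun j => le_of_eq (abs_of_nonneg (by positivity))⟩ :
    ExpBounded fun j => (j : ℝ) * (C * Real.exp (θ * j))).of_le fun j => ?_
  refine (Finset.abs_sum_le_sum_abs _ _).trans (le_trans ?_ (le_abs_self _))
  refine (Finset.sum_le_card_nsmul _ _ (C * Real.exp (θ * j)) fun i hi => (hf i).trans ?_).trans_eq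
    (by rw [Finset.card_range, nsmul_eq_mul])
  have : (i : ℝ) ≤ j := by exact_mod_cast (Finset.mem_range.1 hi).le
  gcongr

/-- The partial sums of the inverse rates. -/
noncomputable def inverseRateSum (a : ℕ → ℝ) (k : ℕ) : ℝ := ∑ i ∈ Finset.range k, (a i)⁻¹

lemma inverseRateSum_succ (a : ℕ → ℝ) (k : ℕ) :
    inverseRateSum a (k + 1) = inverseRateSum a k + (a k)⁻¹ :=
  Finset.sum_range_succ _ _

/-- The difference of the inverse rate sums; along a balanced chain it is a martingale. -/
noncomputable def rateDifference (b r : ℕ → ℝ) (k j : ℕ) : ℝ :=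
  inverseRateSum r j - inverseRateSum b k

lemma expBounded_rateDifference {b r : ℕ → ℝ} (hre : ExpBounded fun j => (r j)⁻¹) (k : ℕ) :
    ExpBounded (rateDifference b r k) :=
  hre.sum_range.sub (ExpBounded.const _)

namespace BalancedChain

variable {Ω : Type*} [MeasurableSpace Ω] {μ : Measure Ω} [IsProbabilityMeasure μ]
  {b r : ℕ → ℝ} {X : ℕ → Ω → ℕ}

/-- The martingale property of the rate difference. -/
lemma integral_mul_rateDifference (h : BalancedChain μ b r X) (hb : ∀ i, 0 < b i)
    (hr : ∀ i, 0 < r i) (hr0 : Tendsto r atTop (nhds 0)) (hre : ExpBounded fun j => (r j)⁻¹)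
    {f : ℕ → ℝ} (hf : ExpBounded f) {n m : ℕ} (hnm : n ≤ m) :
    ∫ ω, f (X n ω) * rateDifference b r m (X m ω) ∂μ =
      ∫ ω, f (X n ω) * rateDifference b r n (X n ω) ∂μ := by
  induction m, hnm using Nat.le_induction with
  | base => rfl
  | succ k hk ih =>
    rw [← ih]
    have hfi := h.integrable_comp hb hr hr0 hf n
    have hd : ∀ j, (inverseRateSum r (j + 1) - inverseRateSum r j) * r j = 1 := fun j => by
      rw [inverseRateSum_succ, add_sub_cancel_left, inv_mul_cancel₀ (hr j).ne']
    have hid := h.integral_mul_sub hb hr hk f (inverseRateSum r)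
      (by simpa only [hd, mul_one] using hfi)
    simp only [hd, mul_one] at hid
    have hI : ∀ k, Integrable (fun ω => f (X n ω) * inverseRateSum r (X k ω)) μ := fun k =>
      h.integrable_mul_comp hb hr hr0 hf hre.sum_range n k
    simp only [rateDifference, mul_sub] at hid ⊢
    rw [integral_sub (hI _) (hI _)] at hid
    rw [integral_sub (hI _) (hfi.mul_const _), integral_sub (hI _) (hfi.mul_const _),
      integral_mul_const, integral_mul_const, inverseRateSum_succ b]
    have hbk := (hb k).ne'
    rw [← eq_inv_mul_iff_mul_eq₀ hbk] at hid
    linear_combination hid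

lemma integral_rateDifference (h : BalancedChain μ b r X) (hb : ∀ i, 0 < b i)
    (hr : ∀ i, 0 < r i) (hr0 : Tendsto r atTop (nhds 0)) (hre : ExpBounded fun j => (r j)⁻¹)
    (k : ℕ) : ∫ ω, rateDifference b r k (X k ω) ∂μ = 0 := by
  have := h.integral_mul_rateDifference hb hr hr0 hre (ExpBounded.const 1) (Nat.zero_le k)
  simp only [one_mul] at this
  rw [this, ← integral_zero Ω ℝ]
  refine integral_congr_ae ?_
  filter_upwards [h.zero] with ω hω
  simp [hω, rateDifference, inverseRateSum]

/-- The increment of the second moment of the rate difference. -/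
lemma integral_sq_rateDifference_succ (h : BalancedChain μ b r X) (hb : ∀ i, 0 < b i)
    (hr : ∀ i, 0 < r i) (hr0 : Tendsto r atTop (nhds 0)) (hre : ExpBounded fun j => (r j)⁻¹)
    (k : ℕ) :
    ∫ ω, rateDifference b r (k + 1) (X (k + 1) ω) ^ 2 ∂μ =
      ∫ ω, rateDifference b r k (X k ω) ^ 2 ∂μ +
        ((b k)⁻¹ ^ 2 + (b k)⁻¹ * ∫ ω, (r (X (k + 1) ω))⁻¹ ∂μ) := by
  set a := (b k)⁻¹ with ha
  have hYb := fun k => expBounded_rateDifference (b := b) hre k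
  have hY := fun k l => h.integrable_comp hb hr hr0 (hYb k) l
  have hY2 : ∀ k l, Integrable (fun ω => rateDifference b r k (X l ω) ^ 2) μ := fun k l => by
    simpa only [pow_two] using h.integrable_comp hb hr hr0 ((hYb k).mul (hYb k)) l
  have hA := h.integrable_comp hb hr hr0 hre (k + 1)
  set F : ℕ → ℝ := fun j => rateDifference b r (k + 1) j ^ 2 with hF
  have hd : ∀ j, (F (j + 1) - F j) * r j = 2 * rateDifference b r (k + 1) j + (r j)⁻¹ := by
    intro j
    have hrj := (hr j).ne'
    simp only [hF, rateDifference, inverseRateSum_succ r]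
    field_simp; ring
  have hid := h.integral_mul_sub hb hr (Nat.zero_le k) (fun _ => 1) F (by
    simp only [hd, one_mul]
    exact ((hY (k + 1) (k + 1)).const_mul 2).add hA)
  simp only [hd, one_mul] at hid
  have e : ∀ ω, F (X k ω) = rateDifference b r k (X k ω) ^ 2 -
      2 * a * rateDifference b r k (X k ω) + a ^ 2 := fun ω => by
    simp only [hF, rateDifference, inverseRateSum_succ b]; ring
  simp only [e] at hid
  have hI1 := (hY k k).const_mul (2 * a)
  have hI2 : Integrable (fun ω => rateDifference b r k (X k ω) ^ 2 -
      2 * a * rateDifference b r k (X k ω)) μ := (hY2 k k).sub hI1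
  have hI3 : Integrable (fun ω => rateDifference b r k (X k ω) ^ 2 -
      2 * a * rateDifference b r k (X k ω) + a ^ 2) μ := hI2.add (integrable_const _)
  rw [integral_sub (hY2 _ _) hI3,
    integral_add hI2 (integrable_const _), integral_sub (hY2 _ _) hI1, integral_const_mul,
    integral_add ((hY _ _).const_mul 2) hA, integral_const_mul,
    h.integral_rateDifference hb hr hr0 hre, h.integral_rateDifference hb hr hr0 hre,
    integral_const, probReal_univ, ← eq_inv_mul_iff_mul_eq₀ (hb k).ne'] at hid
  simp only [smul_eq_mul] at hid
  linear_combination hid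

end BalancedChain

/-- The variance of a small square integrable perturbation of a centred random variable. -/
lemma abs_variance_add_sub_le {Ω : Type*} [MeasurableSpace Ω] {μ : Measure Ω}
    [IsProbabilityMeasure μ] {P E : Ω → ℝ} (hP : MemLp P 2 μ) (hE : MemLp E 2 μ)
    (hP0 : ∫ ω, P ω ∂μ = 0) {l : ℝ} (hl : 0 < l) :
    |variance (fun ω => P ω + E ω) μ - ∫ ω, P ω ^ 2 ∂μ| ≤
      l * ∫ ω, P ω ^ 2 ∂μ + (l⁻¹ + 1) * ∫ ω, E ω ^ 2 ∂μ := by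
  have hPi := hP.integrable one_le_two
  have hEi := hE.integrable one_le_two
  have hPE : Integrable (fun ω => P ω * E ω) μ := hP.integrable_mul hE
  have hPP : Integrable (fun ω => P ω ^ 2 + 2 * (P ω * E ω)) μ :=
    hP.integrable_sq.add (hPE.const_mul 2)
  have hmean : (∫ ω, E ω ∂μ) ^ 2 ≤ ∫ ω, E ω ^ 2 ∂μ := by
    have h1 := variance_nonneg E μ
    rw [variance_eq_sub hE] at h1
    simpa using h1
  have hvar : variance (fun ω => P ω + E ω) μ = ∫ ω, P ω ^ 2 ∂μ + 2 * ∫ ω, P ω * E ω ∂μ +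
      ∫ ω, E ω ^ 2 ∂μ - (∫ ω, E ω ∂μ) ^ 2 := by
    change variance (P + E) μ = _
    rw [variance_eq_sub (hP.add hE)]
    simp only [Pi.pow_apply, Pi.add_apply]
    have e : ∀ ω, (P ω + E ω) ^ 2 = P ω ^ 2 + 2 * (P ω * E ω) + E ω ^ 2 := fun ω => by ring
    simp only [e]
    rw [integral_add hPP hE.integrable_sq,
      integral_add hP.integrable_sq (hPE.const_mul 2), integral_const_mul,
      integral_add hPi hEi, hP0, zero_add]
  have hcross : |2 * ∫ ω, P ω * E ω ∂μ| ≤ l * ∫ ω, P ω ^ 2 ∂μ + l⁻¹ * ∫ ω, E ω ^ 2 ∂μ := by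
    rw [← integral_const_mul, ← integral_const_mul, ← integral_const_mul,
      ← integral_add (hP.integrable_sq.const_mul _) (hE.integrable_sq.const_mul _)]
    refine (abs_integral_le_integral_abs).trans (integral_mono (hPE.const_mul 2).abs
      ((hP.integrable_sq.const_mul _).add (hE.integrable_sq.const_mul _)) fun ω => ?_)
    simp only
    have h1 : l * P ω ^ 2 + l⁻¹ * E ω ^ 2 - 2 * (P ω * E ω) = l⁻¹ * (l * P ω - E ω) ^ 2 := by
      field_simp; ring
    have h2 : l * P ω ^ 2 + l⁻¹ * E ω ^ 2 + 2 * (P ω * E ω) = l⁻¹ * (l * P ω + E ω) ^ 2 := by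
      field_simp; ring
    have h3 : 0 ≤ l⁻¹ * (l * P ω - E ω) ^ 2 := by positivity
    have h4 : 0 ≤ l⁻¹ * (l * P ω + E ω) ^ 2 := by positivity
    rw [abs_le]
    constructor <;> linarith
  rw [hvar]
  rw [abs_le] at hcross ⊢
  have := sq_nonneg (∫ ω, E ω ∂μ)
  constructor <;> linarith

/-- Comparison of the values of a power function on a dyadic window. -/
lemma exists_rpow_sub_le {α : ℝ} (hα : 0 < α) :
    ∃ C : ℝ, 0 ≤ C ∧ ∀ n k m : ℕ, 1 ≤ n → n ≤ k → k ≤ m → m ≤ 2 * n →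
      |(2 * (k : ℝ)) ^ α - (2 * (m : ℝ)) ^ α| ≤
        C * (2 * (m : ℝ)) ^ α * (((m : ℝ) - n) / n) := by
  obtain ⟨C, hC, hpow⟩ := exists_abs_rpow_sub_one_le hα
  refine ⟨C * Real.exp C, by positivity, fun n k m hn hnk hkm hm => ?_⟩
  have hn0 : (0:ℝ) < n := by exact_mod_cast hn
  have hnk' : (n:ℝ) ≤ k := by exact_mod_cast hnk
  have hkm' : (k:ℝ) ≤ m := by exact_mod_cast hkm
  have hm' : (m:ℝ) ≤ 2 * n := by exact_mod_cast hm
  have hm0 : (0:ℝ) < m := by linarith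
  have e : (2 * (k : ℝ)) ^ α = (2 * (m : ℝ)) ^ α * ((k : ℝ) / m) ^ α := by
    rw [← Real.mul_rpow (by positivity) (by positivity)]; congr 1; field_simp
  have e2 : (2 * (m : ℝ)) ^ α * ((k : ℝ) / m) ^ α - (2 * (m : ℝ)) ^ α =
    (2 * (m : ℝ)) ^ α * (((k : ℝ) / m) ^ α - 1) := by ring
  have hx : |(k : ℝ) / m - 1| ≤ ((m : ℝ) - n) / n := by
    have : (k : ℝ) / m - 1 = -(((m : ℝ) - k) / m) := by field_simp; ring
    rw [this, abs_neg, abs_of_nonneg (div_nonneg (by linarith) hm0.le)]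
    exact div_le_div₀ (by linarith) (by linarith) hn0 (by linarith)
  have hx1 : ((m : ℝ) - n) / n ≤ 1 := by rw [div_le_one hn0]; linarith
  have hx0 : 0 ≤ ((m : ℝ) - n) / n := div_nonneg (by linarith) hn0.le
  rw [e, e2, abs_mul, abs_of_nonneg (by positivity)]
  calc _ ≤ (2 * (m : ℝ)) ^ α * (C * |(k : ℝ) / m - 1| * Real.exp (C * |(k : ℝ) / m - 1|)) :=
        mul_le_mul_of_nonneg_left (hpow _ (by positivity)) (by positivity)
    _ ≤ (2 * (m : ℝ)) ^ α * (C * (((m : ℝ) - n) / n) * Real.exp (C * 1)) := by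
        gcongr; exact hx.trans hx1
    _ = _ := by rw [mul_one]; ring

lemma abs_sq_add_mul_sub_le {a A s δ : ℝ} (hs : 0 ≤ s) (hδ : 0 ≤ δ) (ha : |a - s| ≤ s * δ)
    (hA : |A - s| ≤ s * δ) : |a ^ 2 + a * A - 2 * s ^ 2| ≤ s ^ 2 * (4 * δ + 2 * δ ^ 2) := by
  have e : a ^ 2 + a * A - 2 * s ^ 2 =
    (a - s) * (a - s) + (a - s) * (A - s) + (3 * s * (a - s) + s * (A - s)) := by ring
  have h1 : |(a - s) * (a - s)| ≤ s * δ * (s * δ) := by rw [abs_mul]; gcongr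
  have h2 : |(a - s) * (A - s)| ≤ s * δ * (s * δ) := by rw [abs_mul]; gcongr
  have h3 : |3 * s * (a - s)| ≤ 3 * s * (s * δ) := by
    rw [abs_mul, abs_of_nonneg (by positivity)]; gcongr
  have h4 : |s * (A - s)| ≤ s * (s * δ) := by rw [abs_mul, abs_of_nonneg hs]; gcongr
  rw [e]
  rw [abs_le] at *
  constructor <;> linarith

namespace BalancedChain

variable {Ω : Type*} [MeasurableSpace Ω] {μ : Measure Ω} [IsProbabilityMeasure μ]
  {b r : ℕ → ℝ} {X : ℕ → Ω → ℕ} {α : ℝ} {q : ℕ}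

/-- Moment estimates on the time window `[n, 2 n]`. -/
lemma exists_moment_bounds (h : BalancedChain μ b r X) (hα : 0 < α)
    (hb : ∀ i, 0 < b i) (hr : ∀ i, 0 < r i)
    (hbs : PowerSandwich α q fun i => (b i)⁻¹) (hrs : PowerSandwich α q fun i => (r i)⁻¹) :
    ∃ C : ℝ, 0 ≤ C ∧ ∃ N : ℕ, 1 ≤ N ∧ ∀ n, N ≤ n → ∀ k, n ≤ k → k ≤ 2 * n →
      ∫ ω, rateDifference b r k (X k ω) ^ 2 ∂μ ≤ C * n * ((2 * (k : ℝ)) ^ α) ^ 2 ∧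
      ∫ ω, (rateDifference b r k (X k ω) - (2 * (k : ℝ)) ^ α * ((X k ω : ℝ) - k)) ^ 2 ∂μ ≤
        C * ((2 * (k : ℝ)) ^ α) ^ 2 ∧
      |∫ ω, (r (X k ω))⁻¹ ∂μ - (2 * (k : ℝ)) ^ α| ≤ C * (2 * (k : ℝ)) ^ α * (Real.sqrt n)⁻¹ := by
  have hr0 := hrs.tendsto_rate hα
  have hre := hrs.expBounded hα
  obtain ⟨M, N₁, hM⟩ := h.exists_exp_moment_bound hα hb hr hbs hrs
  obtain ⟨C₁, hC₁, N₂, hN₂⟩ := hrs.exists_sum_sub_sum_le_exp hα hbs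
  obtain ⟨C₂, hC₂, N₃, hN₃, hN₃'⟩ := hrs.exists_abs_sub_le_exp hα
  refine ⟨(C₁ + 2) ^ 2 * |M| + C₁ ^ 2 * |M| + C₂ * |M|, by positivity, N₁ + N₂ + N₃, by omega,
    fun n hn k hk hk2 => ?_⟩
  have hn1 : (1:ℝ) ≤ n := by exact_mod_cast (by omega : 1 ≤ n)
  set σ := Real.sqrt n with hσ
  have hσ1 : 1 ≤ σ := Real.one_le_sqrt.2 hn1
  have hσσ : σ * σ = n := Real.mul_self_sqrt (by linarith)
  set s := (2 * (k : ℝ)) ^ α with hs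
  have hs0 : 0 ≤ s := by positivity
  have hθ0 : 0 < σ⁻¹ := by positivity
  have hEb : ExpBounded fun j => Real.exp (σ⁻¹ * |(j : ℝ) - k|) := ExpBounded.exp_abs_sub hθ0 k
  have hint : ∀ {f : ℕ → ℝ} {c : ℝ}, ExpBounded f → 0 ≤ c →
      (∀ j : ℕ, f j ≤ c * Real.exp (σ⁻¹ * |(j : ℝ) - k|)) → ∫ ω, f (X k ω) ∂μ ≤ c * |M| := by
    intro f c hf hc hle
    calc _ ≤ ∫ ω, c * Real.exp (σ⁻¹ * |(X k ω : ℝ) - k|) ∂μ :=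
          integral_mono (h.integrable_comp hb hr hr0 hf k)
            ((h.integrable_comp hb hr hr0 hEb k).const_mul c) fun ω => hle _
      _ ≤ c * |M| := by
          rw [integral_const_mul]
          exact mul_le_mul_of_nonneg_left
            ((hM n (by omega) k hk hk2).trans (le_abs_self M)) hc
  have hYb := expBounded_rateDifference (b := b) hre k
  have hdev : ∀ j : ℕ, |rateDifference b r k j - s * ((j : ℝ) - k)| ≤
      C₁ * s * Real.exp (σ⁻¹ * |(j : ℝ) - k| / 2) := fun j => hN₂ n (by omega) k hk j
  have hexp : ∀ x : ℝ, Real.exp (x / 2) ^ 2 = Real.exp x := fun x => by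
    rw [← Real.exp_nat_mul]; congr 1; push_cast; ring
  have hsq : ∀ {x c y : ℝ}, |x| ≤ c * Real.exp (y / 2) → x ^ 2 ≤ c ^ 2 * Real.exp y := by
    intro x c y hx
    rw [← hexp, ← mul_pow, ← sq_abs x]
    gcongr
  have hD : ExpBounded fun j => rateDifference b r k j - s * ((j : ℝ) - k) :=
    hYb.sub ((ExpBounded.const s).mul (ExpBounded.natCast.sub (ExpBounded.const _)))
  refine ⟨?_, ?_, ?_⟩
  · refine (hint (f := fun j => rateDifference b r k j ^ 2) (c := ((C₁ + 2) * s * σ) ^ 2)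
      (by simpa only [pow_two] using hYb.mul hYb) (by positivity) fun j => hsq ?_).trans ?_
    · set d := |(j : ℝ) - k| with hd
      have h1 := hdev j
      have h2 : |s * ((j : ℝ) - k)| ≤ 2 * s * σ * Real.exp (σ⁻¹ * d / 2) := by
        rw [abs_mul, abs_of_nonneg hs0]
        have h3 : σ⁻¹ * d ≤ 2 * Real.exp (σ⁻¹ * d / 2) := by
          linarith [Real.add_one_le_exp (σ⁻¹ * d / 2)]
        calc s * d = s * σ * (σ⁻¹ * d) := by field_simp
          _ ≤ s * σ * (2 * Real.exp (σ⁻¹ * d / 2)) := by gcongr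
          _ = _ := by ring
      have h4 : C₁ * s * Real.exp (σ⁻¹ * d / 2) ≤ C₁ * s * σ * Real.exp (σ⁻¹ * d / 2) := by
        exact mul_le_mul_of_nonneg_right (le_mul_of_one_le_right (by positivity) hσ1)
          (Real.exp_pos _).le
      rw [abs_le] at h1 h2 ⊢
      constructor <;> linarith
    · have e : ((C₁ + 2) * s * σ) ^ 2 * |M| = (C₁ + 2) ^ 2 * |M| * n * s ^ 2 := by
        rw [← hσσ]; ring
      rw [e]; gcongr
      have : 0 ≤ C₁ ^ 2 * |M| + C₂ * |M| := by positivity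
      linarith
  · refine (hint (f := fun j => (rateDifference b r k j - s * ((j : ℝ) - k)) ^ 2)
      (c := (C₁ * s) ^ 2) (by simpa only [pow_two] using hD.mul hD) (by positivity)
      fun j => hsq (hdev j)).trans ?_
    have e : (C₁ * s) ^ 2 * |M| = C₁ ^ 2 * |M| * s ^ 2 := by ring
    rw [e]; gcongr
    have : 0 ≤ (C₁ + 2) ^ 2 * |M| := by positivity
    have : 0 ≤ C₂ * |M| := by positivity
    linarith
  · have hA := h.integrable_comp hb hr hr0 hre k
    have e : ∫ ω, (r (X k ω))⁻¹ ∂μ - s = ∫ ω, ((r (X k ω))⁻¹ - s) ∂μ := by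
      rw [integral_sub hA (integrable_const _), integral_const, probReal_univ, one_smul]
    rw [e]
    refine (abs_integral_le_integral_abs).trans ((hint (f := fun j => |(r j)⁻¹ - s|)
      (c := C₂ * s * σ⁻¹) (hre.sub (ExpBounded.const s)).abs (by positivity)
      fun j => (hN₃' n (by omega) k hk j).trans ?_).trans ?_)
    · gcongr
      have : 0 ≤ σ⁻¹ * |(j : ℝ) - k| := by positivity
      linarith
    · have e : C₂ * s * σ⁻¹ * |M| = C₂ * |M| * s * σ⁻¹ := by ring
      rw [e]; gcongr
      have : 0 ≤ (C₁ + 2) ^ 2 * |M| := by positivity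
      have : 0 ≤ C₁ ^ 2 * |M| := by positivity
      linarith

/-- The growth of the second moment of the rate difference on the time window `[n, 2 n]`. -/
lemma exists_integral_sq_sub_le (h : BalancedChain μ b r X) (hα : 0 < α)
    (hb : ∀ i, 0 < b i) (hr : ∀ i, 0 < r i)
    (hbs : PowerSandwich α q fun i => (b i)⁻¹) (hrs : PowerSandwich α q fun i => (r i)⁻¹) :
    ∃ C : ℝ, 0 ≤ C ∧ ∃ N : ℕ, ∀ n, N ≤ n → ∀ m, n ≤ m → m ≤ 2 * n →
      |∫ ω, rateDifference b r m (X m ω) ^ 2 ∂μ - ∫ ω, rateDifference b r n (X n ω) ^ 2 ∂μ -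
          2 * ((m : ℝ) - n) * ((2 * (m : ℝ)) ^ α) ^ 2| ≤
        C * ((m : ℝ) - n) * ((2 * (m : ℝ)) ^ α) ^ 2 *
          (((m : ℝ) - n) / n + (Real.sqrt n)⁻¹) := by
  have hr0 := hrs.tendsto_rate hα
  have hre := hrs.expBounded hα
  obtain ⟨C₁, hC₁, N₁, hN₁, hM⟩ := h.exists_moment_bounds hα hb hr hbs hrs
  obtain ⟨C₂, hC₂, N₂, hN₂, hN₂'⟩ := hbs.exists_abs_sub_le_exp hα
  obtain ⟨C₃, hC₃, hpow⟩ := exists_rpow_sub_le hα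
  set K := C₁ + C₂ + C₃ with hK
  refine ⟨4 * K + 4 * K ^ 2, by positivity, N₁ + N₂, fun n hn m hnm hm => ?_⟩
  have hn1 : (1:ℝ) ≤ n := by exact_mod_cast (by omega : 1 ≤ n)
  have hn0 : (0:ℝ) < n := by linarith
  have hnm' : (n:ℝ) ≤ m := by exact_mod_cast hnm
  have hm' : (m:ℝ) ≤ 2 * n := by exact_mod_cast hm
  set θ := (Real.sqrt n)⁻¹ with hθ
  have hθ0 : 0 ≤ θ := by positivity
  have hθ1 : θ ≤ 1 := inv_le_one_of_one_le₀ (Real.one_le_sqrt.2 hn1)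
  set x := ((m : ℝ) - n) / n with hx
  have hx0 : 0 ≤ x := div_nonneg (by linarith) hn0.le
  have hx1 : x ≤ 1 := by rw [hx, div_le_one hn0]; linarith
  set s := (2 * (m : ℝ)) ^ α with hs
  have hs0 : 0 ≤ s := by positivity
  have haux : ∀ {A : ℝ} {k : ℕ}, n ≤ k → k ≤ m →
      |A - (2 * (k : ℝ)) ^ α| ≤ (C₁ + C₂) * (2 * (k : ℝ)) ^ α * θ →
      |A - s| ≤ s * (K * (x + θ)) := by
    intro A k hk hkm hA
    have h1 := hpow n k m (by omega) hk hkm hm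
    have h2 : (2 * (k : ℝ)) ^ α ≤ s := by
      have : (k:ℝ) ≤ m := by exact_mod_cast hkm
      rw [hs]; gcongr
    have h3 : (C₁ + C₂) * (2 * (k : ℝ)) ^ α * θ ≤ (C₁ + C₂) * s * θ := by gcongr
    have h4 : 0 ≤ (C₁ + C₂) * s * x := by positivity
    have h5 : 0 ≤ C₃ * s * θ := by positivity
    have e : s * (K * (x + θ)) = (C₁ + C₂) * s * x + (C₁ + C₂) * s * θ + C₃ * s * x +
      C₃ * s * θ := by rw [hK]; ring
    rw [e]
    refine (abs_sub_le _ ((2 * (k : ℝ)) ^ α) _).trans ?_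
    linarith
  suffices H : ∀ k, n ≤ k → k ≤ m →
      |∫ ω, rateDifference b r k (X k ω) ^ 2 ∂μ - ∫ ω, rateDifference b r n (X n ω) ^ 2 ∂μ -
          2 * ((k : ℝ) - n) * s ^ 2| ≤
        (4 * K + 4 * K ^ 2) * ((k : ℝ) - n) * s ^ 2 * (x + θ) from H m hnm le_rfl
  intro k hk
  induction k, hk using Nat.le_induction with
  | base => simp
  | succ k hk ih =>
    intro hkm
    have ih := ih (by omega)
    have ha : |(b k)⁻¹ - s| ≤ s * (K * (x + θ)) := by
      refine haux hk (by omega) (((hN₂' n (by omega) k hk k)).trans ?_)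
      rw [sub_self, abs_zero, mul_zero, zero_div, Real.exp_zero, mul_one]
      gcongr; linarith
    have hA : |∫ ω, (r (X (k + 1) ω))⁻¹ ∂μ - s| ≤ s * (K * (x + θ)) := by
      refine haux (by omega) hkm
        ((hM n (by omega) (k + 1) (by omega) (by omega)).2.2.trans ?_)
      gcongr; linarith
    have hstep := abs_sq_add_mul_sub_le hs0 (by positivity) ha hA
    rw [h.integral_sq_rateDifference_succ hb hr hr0 hre]
    have h6 : s ^ 2 * (4 * (K * (x + θ)) + 2 * (K * (x + θ)) ^ 2) ≤
        (4 * K + 4 * K ^ 2) * s ^ 2 * (x + θ) := by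
      have h7 : (x + θ) ^ 2 ≤ 2 * (x + θ) := by nlinarith
      have h8 : s ^ 2 * (2 * (K ^ 2 * (x + θ) ^ 2)) ≤ s ^ 2 * (2 * (K ^ 2 * (2 * (x + θ)))) := by
        gcongr
      linarith
    push_cast
    rw [abs_le] at ih hstep ⊢
    constructor <;> linarith

end BalancedChain

namespace BalancedChain

variable {Ω : Type*} [MeasurableSpace Ω] {μ : Measure Ω} [IsProbabilityMeasure μ]
  {b r : ℕ → ℝ} {X : ℕ → Ω → ℕ} {α : ℝ} {q : ℕ}

/-- The second moment of the increments of the normalized rate difference. -/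
lemma integral_sq_normalized_sub (h : BalancedChain μ b r X) (hb : ∀ i, 0 < b i)
    (hr : ∀ i, 0 < r i) (hr0 : Tendsto r atTop (nhds 0)) (hre : ExpBounded fun j => (r j)⁻¹)
    {n m : ℕ} (hnm : n ≤ m) (s t : ℝ) :
    ∫ ω, (t⁻¹ * rateDifference b r m (X m ω) - s⁻¹ * rateDifference b r n (X n ω)) ^ 2 ∂μ =
      (t⁻¹) ^ 2 * (∫ ω, rateDifference b r m (X m ω) ^ 2 ∂μ -
        ∫ ω, rateDifference b r n (X n ω) ^ 2 ∂μ) +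
      (t⁻¹ - s⁻¹) ^ 2 * ∫ ω, rateDifference b r n (X n ω) ^ 2 ∂μ := by
  have hYb := fun k => expBounded_rateDifference (b := b) hre k
  have hm := (h.memLp_comp hb hr hr0 (hYb m) m).integrable_sq
  have hn := (h.memLp_comp hb hr hr0 (hYb n) n).integrable_sq
  have hc := h.integrable_mul_comp hb hr hr0 (hYb n) (hYb m) n m
  have hcross := h.integral_mul_rateDifference hb hr hr0 hre (hYb n) hnm
  simp only [← pow_two] at hcross
  have e : ∀ ω, (t⁻¹ * rateDifference b r m (X m ω) - s⁻¹ * rateDifference b r n (X n ω)) ^ 2 =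
      (t⁻¹) ^ 2 * rateDifference b r m (X m ω) ^ 2 +
        (s⁻¹) ^ 2 * rateDifference b r n (X n ω) ^ 2 -
        2 * t⁻¹ * s⁻¹ * (rateDifference b r n (X n ω) * rateDifference b r m (X m ω)) :=
    fun ω => by ring
  have hsum : Integrable (fun ω => (t⁻¹) ^ 2 * rateDifference b r m (X m ω) ^ 2 +
      (s⁻¹) ^ 2 * rateDifference b r n (X n ω) ^ 2) μ :=
    (hm.const_mul _).add (hn.const_mul _)
  simp only [e]
  rw [integral_sub hsum (hc.const_mul _), integral_add (hm.const_mul _) (hn.const_mul _),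
    integral_const_mul, integral_const_mul, integral_const_mul, hcross]
  ring

/-- The variance of the centred increments of a balanced chain. -/
lemma exists_variance_sub_le (h : BalancedChain μ b r X) (hα : 0 < α)
    (hb : ∀ i, 0 < b i) (hr : ∀ i, 0 < r i)
    (hbs : PowerSandwich α q fun i => (b i)⁻¹) (hrs : PowerSandwich α q fun i => (r i)⁻¹) :
    ∃ C > (0 : ℝ), ∃ N : ℕ, ∀ n, N ≤ n → ∀ m, n ≤ m → m ≤ 2 * n →
      |variance (fun ω => ((X m ω : ℝ) - m) - ((X n ω : ℝ) - n)) μ - 2 * ((m : ℝ) - n)| ≤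
        C * (n : ℝ) ^ ((3 : ℝ) / 4) + C * ((m : ℝ) - n) ^ 2 / n := by
  have hr0 := hrs.tendsto_rate hα
  have hre := hrs.expBounded hα
  obtain ⟨C₁, hC₁, N₁, hN₁, hM⟩ := h.exists_moment_bounds hα hb hr hbs hrs
  obtain ⟨C₂, hC₂, N₂, hN₂⟩ := h.exists_integral_sq_sub_le hα hb hr hbs hrs
  obtain ⟨C₃, hC₃, hpow⟩ := exists_rpow_sub_le hα
  refine ⟨2 + 4 * C₂ + 2 * (C₁ * C₃ ^ 2) + 8 * C₁, by positivity, N₁ + N₂,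
    fun n hn m hnm hm => ?_⟩
  have hn1 : (1:ℝ) ≤ n := by exact_mod_cast (by omega : 1 ≤ n)
  have hn0 : (0:ℝ) < n := by linarith
  have hnm' : (n:ℝ) ≤ m := by exact_mod_cast hnm
  have hm' : (m:ℝ) ≤ 2 * n := by exact_mod_cast hm
  obtain ⟨hVn, hEn, -⟩ := hM n (by omega) n le_rfl (by omega)
  obtain ⟨-, hEm, -⟩ := hM n (by omega) m hnm hm
  have hinc := hN₂ n (by omega) m hnm hm
  have hst := hpow n n m (by omega) le_rfl hnm hm
  have hPsq := h.integral_sq_normalized_sub hb hr hr0 hre hnm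
    ((2 * (n : ℝ)) ^ α) ((2 * (m : ℝ)) ^ α)
  set x := ((m : ℝ) - n) / n with hx
  have hL : (m : ℝ) - n = n * x := by rw [hx]; field_simp
  have hx0 : 0 ≤ x := div_nonneg (by linarith) hn0.le
  have hx1 : x ≤ 1 := by rw [hx, div_le_one hn0]; linarith
  set σ := Real.sqrt n with hσ
  have hσ1 : 1 ≤ σ := Real.one_le_sqrt.2 hn1
  have hσσ : σ * σ = n := Real.mul_self_sqrt hn0.le
  set s := (2 * (n : ℝ)) ^ α with hs
  set t := (2 * (m : ℝ)) ^ α with ht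
  have hs0 : 0 < s := by positivity
  have ht0 : 0 < t := Real.rpow_pos_of_pos (by linarith) _
  set Vn := ∫ ω, rateDifference b r n (X n ω) ^ 2 ∂μ with hVndef
  set Vm := ∫ ω, rateDifference b r m (X m ω) ^ 2 ∂μ with hVmdef
  have hVn0 : 0 ≤ Vn := integral_nonneg fun ω => sq_nonneg _
  set P : Ω → ℝ := fun ω =>
    t⁻¹ * rateDifference b r m (X m ω) - s⁻¹ * rateDifference b r n (X n ω) with hP
  set T := ∫ ω, P ω ^ 2 ∂μ with hT
  have hPsq : T = (t⁻¹) ^ 2 * (Vm - Vn) + (t⁻¹ - s⁻¹) ^ 2 * Vn := hPsq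
  -- the second moment of the martingale part
  have hT1 : |(t⁻¹) ^ 2 * (Vm - Vn) - 2 * (n * x)| ≤ C₂ * n * x ^ 2 + C₂ * σ := by
    rw [hL] at hinc
    have e : (t⁻¹) ^ 2 * (Vm - Vn) - 2 * (n * x) =
        (t⁻¹) ^ 2 * (Vm - Vn - 2 * (n * x) * t ^ 2) := by field_simp
    rw [e, abs_mul, abs_of_nonneg (by positivity)]
    calc _ ≤ (t⁻¹) ^ 2 * (C₂ * (n * x) * t ^ 2 * (x + σ⁻¹)) := by gcongr
      _ = C₂ * n * x ^ 2 + C₂ * (n * σ⁻¹) * x := by field_simp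
      _ = C₂ * n * x ^ 2 + C₂ * σ * x := by rw [← hσσ]; field_simp
      _ ≤ _ := by
        refine add_le_add_right ?_ _
        exact mul_le_of_le_one_right (mul_nonneg hC₂ (by linarith)) hx1
  have hT2 : (t⁻¹ - s⁻¹) ^ 2 * Vn ≤ C₁ * C₃ ^ 2 * n * x ^ 2 := by
    have e : (t⁻¹ - s⁻¹) ^ 2 = (t⁻¹ * s⁻¹) ^ 2 * |s - t| ^ 2 := by
      rw [sq_abs]; field_simp
    calc _ ≤ (t⁻¹ * s⁻¹) ^ 2 * (C₃ * t * x) ^ 2 * (C₁ * n * s ^ 2) := by rw [e]; gcongr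
      _ = _ := by field_simp
  have hT3 : 0 ≤ (t⁻¹ - s⁻¹) ^ 2 * Vn := by positivity
  have hTL : |T - 2 * (n * x)| ≤ (C₂ + C₁ * C₃ ^ 2) * (n * x ^ 2) + C₂ * σ := by
    rw [hPsq]
    rw [abs_le] at hT1 ⊢
    have : 0 ≤ C₁ * C₃ ^ 2 * n * x ^ 2 := by positivity
    constructor <;> linarith
  have hσn : σ ≤ n := by rw [← hσσ]; exact le_mul_of_one_le_left (by linarith) hσ1
  have hTn : T ≤ (2 + 2 * C₂ + C₁ * C₃ ^ 2) * n := by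
    have h1 := (abs_le.1 hTL).2
    have h2 : n * x ≤ n * 1 := by gcongr
    have h3 : (C₂ + C₁ * C₃ ^ 2) * (n * x ^ 2) ≤ (C₂ + C₁ * C₃ ^ 2) * (n * 1) := by
      gcongr; exact pow_le_one₀ hx0 hx1
    have h4 : C₂ * σ ≤ C₂ * n := by gcongr
    linarith
  -- the remainder
  set E : Ω → ℝ := fun ω =>
    s⁻¹ * (rateDifference b r n (X n ω) - s * ((X n ω : ℝ) - n)) -
      t⁻¹ * (rateDifference b r m (X m ω) - t * ((X m ω : ℝ) - m)) with hE
  have hYb := fun k => expBounded_rateDifference (b := b) hre k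
  have hDb : ∀ k (c : ℝ), ExpBounded fun j => rateDifference b r k j - c * ((j : ℝ) - k) :=
    fun k c => (hYb k).sub ((ExpBounded.const c).mul (ExpBounded.natCast.sub (ExpBounded.const _)))
  have hRn := h.memLp_comp hb hr hr0 (hDb n s) n
  have hRm := h.memLp_comp hb hr hr0 (hDb m t) m
  have hEL : MemLp E 2 μ := (hRn.const_mul s⁻¹).sub (hRm.const_mul t⁻¹)
  have hPL : MemLp P 2 μ := ((h.memLp_comp hb hr hr0 (hYb m) m).const_mul t⁻¹).sub
    ((h.memLp_comp hb hr hr0 (hYb n) n).const_mul s⁻¹)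
  have hP0 : ∫ ω, P ω ∂μ = 0 := by
    rw [hP, integral_sub ((h.integrable_comp hb hr hr0 (hYb m) m).const_mul _)
      ((h.integrable_comp hb hr hr0 (hYb n) n).const_mul _), integral_const_mul,
      integral_const_mul, h.integral_rateDifference hb hr hr0 hre,
      h.integral_rateDifference hb hr hr0 hre]
    ring
  have hE2 : ∫ ω, E ω ^ 2 ∂μ ≤ 4 * C₁ := by
    have hIn := hRn.integrable_sq.const_mul (2 * (s⁻¹) ^ 2)
    have hIm := hRm.integrable_sq.const_mul (2 * (t⁻¹) ^ 2)
    refine (integral_mono hEL.integrable_sq (hIn.add hIm) fun ω => ?_).trans ?_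
    · have aux : ∀ u v : ℝ, (s⁻¹ * u - t⁻¹ * v) ^ 2 ≤
          2 * (s⁻¹) ^ 2 * u ^ 2 + 2 * (t⁻¹) ^ 2 * v ^ 2 := fun u v => by
        linarith [sq_nonneg (s⁻¹ * u + t⁻¹ * v)]
      exact aux _ _
    · rw [integral_add' hIn hIm, integral_const_mul, integral_const_mul]
      calc _ ≤ 2 * (s⁻¹) ^ 2 * (C₁ * s ^ 2) + 2 * (t⁻¹) ^ 2 * (C₁ * t ^ 2) := by gcongr
        _ = 4 * C₁ := by field_simp; ring
  have hS : (fun ω => ((X m ω : ℝ) - m) - ((X n ω : ℝ) - n)) = fun ω => P ω + E ω := by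
    funext ω
    simp only [hP, hE]
    field_simp
    ring
  rw [hS, hL]
  set u := (n : ℝ) ^ ((1 : ℝ) / 4) with hu
  have hu1 : 1 ≤ u := Real.one_le_rpow hn1 (by norm_num)
  have hupow : ∀ k : ℕ, u ^ k = (n : ℝ) ^ ((k : ℝ) / 4) := fun k => by
    rw [hu, ← Real.rpow_natCast, ← Real.rpow_mul hn0.le]; congr 1; ring
  have hu3 : (n : ℝ) ^ ((3 : ℝ) / 4) = u ^ 3 := by rw [hupow]; norm_num
  have hu4 : (n : ℝ) = u ^ 4 := by rw [hupow]; norm_num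
  have hu2 : σ = u ^ 2 := by
    rw [hσ, Real.sqrt_eq_rpow, hupow]; norm_num
  have hvar := abs_variance_add_sub_le hPL hEL hP0 (l := u⁻¹) (by positivity)
  rw [inv_inv] at hvar
  have h1 : u⁻¹ * T ≤ (2 + 2 * C₂ + C₁ * C₃ ^ 2) * u ^ 3 := by
    calc u⁻¹ * T ≤ u⁻¹ * ((2 + 2 * C₂ + C₁ * C₃ ^ 2) * n) := by gcongr
      _ = _ := by rw [hu4]; field_simp
  have h2 : (u + 1) * ∫ ω, E ω ^ 2 ∂μ ≤ 8 * C₁ * u ^ 3 := by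
    have h3 : u + 1 ≤ 2 * u ^ 3 := by linarith [le_self_pow₀ hu1 three_ne_zero]
    calc _ ≤ (2 * u ^ 3) * (4 * C₁) := by
          gcongr
      _ = _ := by ring
  have h3 : C₂ * σ ≤ C₂ * u ^ 3 := by
    rw [hu2]; gcongr
    norm_num
  have h4 : (2 + 4 * C₂ + 2 * (C₁ * C₃ ^ 2) + 8 * C₁) * (n * x) ^ 2 / n =
      (2 + 4 * C₂ + 2 * (C₁ * C₃ ^ 2) + 8 * C₁) * (n * x ^ 2) := by field_simp
  have h5 : (C₂ + C₁ * C₃ ^ 2) * (n * x ^ 2) ≤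
      (2 + 4 * C₂ + 2 * (C₁ * C₃ ^ 2) + 8 * C₁) * (n * x ^ 2) := by
    refine mul_le_mul_of_nonneg_right ?_ (by positivity)
    have : 0 ≤ C₁ * C₃ ^ 2 := by positivity
    linarith
  have h6 : 0 ≤ (C₂ + C₁ * C₃ ^ 2) * u ^ 3 := by positivity
  rw [h4, hu3]
  refine (abs_sub_le _ T _).trans ?_
  linarith

end BalancedChain

theorem variance_discrepancy_at_tau_diff {Ω : Type*} [MeasurableSpace Ω] (μ : MeasureTheory.Measure Ω) [MeasureTheory.IsProbabilityMeasure μ]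
    (α B : ℝ) (hα : 0 < α) (w : ℕ → ℝ) (hw : ∀ n, 0 < w n)
    (hasymp : WeightAsymp w α B)
    (b r : ℕ → ℝ) (hb : ∀ i, 0 < b i) (hr : ∀ i, 0 < r i)
    (hchoice : UrnChoice w b r) (U : Urn μ b r) :
    ∃ C₆ > (0:ℝ), ∃ N : ℕ, ∀ n : ℕ, N ≤ n → ∀ m : ℕ, n ≤ m → m ≤ 2*n →
      |variance (fun ω => (U.D (U.tau m ω) ω : ℝ) - (U.D (U.tau n ω) ω : ℝ)) μ
          - 2*((m:ℝ) - (n:ℝ))|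
        ≤ C₆ * (n:ℝ) ^ ((3:ℝ)/4) + C₆ * ((m:ℝ) - (n:ℝ))^2 / (n:ℝ) := by
  obtain ⟨q, hbs, hrs⟩ := hchoice.exists_powerSandwich hα hw hasymp
  have hr0 := hrs.tendsto_rate hα
  obtain ⟨C, hC, N, hN⟩ := (U.balancedChain hb hr hr0).exists_variance_sub_le hα hb hr hbs hrs
  refine ⟨C, hC, N, fun n hn m hnm hm => ?_⟩
  rw [← variance_congr]
  · exact hN n hn m hnm hm
  · filter_upwards [U.ae_blueUnbounded hb hr hr0] with ω hω
    rw [hω.D_tau, hω.D_tau]
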